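/- arXiv:1203.6080 — 5 statements merged into one kernel-verified Lean document; each statement's English description precedes it below -/
import Mathlib

section
/- If X is a compact topological space, Y is a Hausdorff topological space, and X is cleavable over Y, then X is Hausdorff. -/
open Set Topology

/-- `X` is cleavable over `Y`: for every `A ⊆ X` there is a continuous `f : X → Y`
with `f '' A ∩ f '' (X \ A) = ∅`. -/
def Cleavable (X Y : Type*) [TopologicalSpace X] [TopologicalSpace Y] : Prop :=
  ∀ A : Set X, ∃ f : X → Y, Continuous f ∧ f '' A ∩ f '' Aᶜ = ∅

theorem cleavable_over_T2_of_compact (X Y : Type*) [TopologicalSpace X] [TopologicalSpace Y]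
    [CompactSpace X] [T2Space Y] (h : Cleavable X Y) : T2Space X := by
  refine ⟨fun x y hxy => ?_⟩
  obtain ⟨f, hf, hd⟩ := h {x}
  have hne : f x ≠ f y := fun he => by
    have hmem : f x ∈ f '' {x} ∩ f '' {x}ᶜ := ⟨⟨x, rfl, rfl⟩, ⟨y, hxy.symm, he.symm⟩⟩
    rw [hd] at hmem
    exact hmem
  exact separated_by_continuous hf hne
end

section
/- If X is a compact Hausdorff topological space, Y is a scattered topological space, and X is cleavable over Y, then X is scattered. -/
open Set Topology

/-- A space is scattered if every nonempty subset has a point isolated in it. -/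
def Scattered (X : Type*) [TopologicalSpace X] : Prop :=
  ∀ S : Set X, S.Nonempty → ∃ x ∈ S, ∃ U : Set X, IsOpen U ∧ U ∩ S = {x}

/-- Two open sets meeting a set without isolated points, with disjoint closures, can be found
inside any open set meeting it. -/
theorem exists_open_split {X : Type*} [TopologicalSpace X] [T25Space X] {S : Set X}
    (hS : ∀ x ∈ S, ∀ U : Set X, IsOpen U → U ∩ S ≠ {x}) {U : Set X} (hU : IsOpen U)
    (hne : (U ∩ S).Nonempty) :
    ∃ V : Bool → Set X, (∀ b, IsOpen (V b) ∧ (V b ∩ S).Nonempty ∧ V b ⊆ U) ∧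
      Disjoint (closure (V false)) (closure (V true)) := by
  obtain ⟨x, hxU, hxS⟩ := hne
  obtain ⟨y, ⟨hyU, hyS⟩, hyx⟩ : ∃ y ∈ U ∩ S, y ≠ x := by
    by_contra! hc
    exact hS x hxS U hU (Subset.antisymm hc (singleton_subset_iff.2 ⟨hxU, hxS⟩))
  obtain ⟨u, hxu, hu, v, hyv, hv, huv⟩ := exists_open_nhds_disjoint_closure hyx.symm
  refine ⟨fun b => U ∩ cond b v u, ?_, ?_⟩
  · rintro (_ | _)
    · exact ⟨hU.inter hu, ⟨x, ⟨hxU, hxu⟩, hxS⟩, inter_subset_left⟩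
    · exact ⟨hU.inter hv, ⟨y, ⟨hyU, hyv⟩, hyS⟩, inter_subset_left⟩
  · exact huv.mono (closure_mono inter_subset_right) (closure_mono inter_subset_right)

/-- A nonempty set without isolated points carries a Cantor scheme of open sets. -/
theorem exists_open_cantorScheme {X : Type*} [TopologicalSpace X] [T25Space X] {S : Set X}
    (hne : S.Nonempty) (hS : ∀ x ∈ S, ∀ U : Set X, IsOpen U → U ∩ S ≠ {x}) :
    ∃ U : List Bool → Set X, (∀ s, (U s).Nonempty) ∧ (∀ b s, U (b :: s) ⊆ U s) ∧
      ∀ s, Disjoint (closure (U (false :: s))) (closure (U (true :: s))) := by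
  let T := {U : Set X // IsOpen U ∧ (U ∩ S).Nonempty}
  have split : ∀ U : T, ∃ V : Bool → T, (∀ b, (V b).1 ⊆ U.1) ∧
      Disjoint (closure (V false).1) (closure (V true).1) := fun U => by
    obtain ⟨V, hV, hd⟩ := exists_open_split hS U.2.1 U.2.2
    exact ⟨fun b => ⟨V b, (hV b).1, (hV b).2.1⟩, fun b => (hV b).2.2, hd⟩
  choose V hVU hd using split
  let W : List Bool → T := fun s =>
    s.rec ⟨univ, isOpen_univ, by simpa using hne⟩ fun b _ U => V U b
  exact ⟨fun s => (W s).1, fun s => (W s).2.2.left, fun b s => hVU (W s) b, fun s => hd (W s)⟩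

theorem isLocallyConstant_res {α : Type*} [TopologicalSpace α] [DiscreteTopology α] (n : ℕ) :
    IsLocallyConstant fun z : ℕ → α => PiNat.res z n := by
  induction n with
  | zero => exact IsLocallyConstant.const _
  | succ n ih =>
    exact ((IsLocallyConstant.iff_continuous _).2 (continuous_apply n)).comp₂ ih List.cons

/-- The eventually constant sequences with a given limit value are dense. -/
theorem exists_mem_eventually_eq {α : Type*} [TopologicalSpace α] {O : Set (ℕ → α)}
    (hO : IsOpen O) (hne : O.Nonempty) (a : α) : ∃ z ∈ O, ∀ᶠ n in Filter.atTop, z n = a := by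
  obtain ⟨x, hx⟩ := hne
  have ht : Filter.Tendsto (fun k n => if n < k then x n else a) Filter.atTop (𝓝 x) := by
    refine tendsto_pi_nhds.2 fun n => tendsto_const_nhds.congr' ?_
    filter_upwards [Filter.eventually_gt_atTop n] with k hk
    simp [hk]
  obtain ⟨k, hk⟩ := (ht.eventually (hO.mem_nhds hx)).exists
  refine ⟨_, hk, ?_⟩
  filter_upwards [Filter.eventually_ge_atTop k] with n hn
  simp [hn]

/-- A compact Hausdorff space which is not scattered has a subset which is mapped onto the Cantor
space by a function with closed graph. -/
theorem exists_graph_onto_cantor {X : Type*} [TopologicalSpace X] [CompactSpace X] [T2Space X]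
    (hX : ¬ Scattered X) :
    ∃ R : Set (X × (ℕ → Bool)), IsClosed R ∧ InjOn Prod.fst R ∧ Prod.snd '' R = univ := by
  unfold Scattered at hX
  push Not at hX
  obtain ⟨S, hne, hS⟩ := hX
  obtain ⟨U, hU, hsub, hd⟩ := exists_open_cantorScheme hne hS
  refine ⟨{q | ∀ n, q.1 ∈ closure (U (PiNat.res q.2 n))}, ?_, ?_, ?_⟩
  · have : {q : X × (ℕ → Bool) | ∀ n, q.1 ∈ closure (U (PiNat.res q.2 n))} =
        ⋂ n, ⋂ s, {q | PiNat.res q.2 n = s → q.1 ∈ closure (U s)} := by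
      ext q
      simp
    rw [this]
    refine isClosed_iInter fun n => isClosed_iInter fun s => isClosed_imp ?_ ?_
    · exact ((isLocallyConstant_res n).isOpen_fiber s).preimage continuous_snd
    · exact isClosed_closure.preimage continuous_fst
  · rintro ⟨p, z⟩ hz ⟨_, w⟩ hw rfl
    have key : ∀ n, PiNat.res z n = PiNat.res w n → z n = w n := fun n hn => by
      have h1 := hz (n + 1)
      have h2 := hw (n + 1)
      simp only [PiNat.res_succ, ← hn] at h1 h2
      have := disjoint_left.1 (hd (PiNat.res z n))
      cases hzn : z n <;> cases hwn : w n <;> simp only [hzn, hwn] at h1 h2 ⊢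
      · exact (this h1 h2).elim
      · exact (this h2 h1).elim
    have hres : ∀ n, PiNat.res z n = PiNat.res w n := fun n => by
      induction n with
      | zero => rfl
      | succ n ih => rw [PiNat.res_succ, PiNat.res_succ, ih, key n ih]
    exact Prod.ext rfl (funext fun n => key n (hres n))
  · refine eq_univ_of_forall fun z => ?_
    obtain ⟨p, hp⟩ := IsCompact.nonempty_iInter_of_sequence_nonempty_isCompact_isClosed
      (fun n => closure (U (PiNat.res z n))) (fun n => closure_mono (hsub _ _))
      (fun n => (hU _).closure) isClosed_closure.isCompact fun n => isClosed_closure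
    exact ⟨(p, z), mem_iInter.1 hp, rfl⟩

/-- `exists_compact_surjective_zorn_subset` for a codomain in the lowest universe. -/
theorem exists_compact_image_eq_univ_minimal {D : Type*} {A : Type} [TopologicalSpace D]
    [CompactSpace D] [TopologicalSpace A] [T1Space A] {f : D → A} (hf : Continuous f)
    (hsurj : f.Surjective) :
    ∃ E : Set D, CompactSpace E ∧ f '' E = univ ∧
      ∀ E₀ : Set E, E₀ ≠ univ → IsClosed E₀ → E.domRestrict f '' E₀ ≠ univ := by
  obtain ⟨E, hE, hEuniv, hmin⟩ := exists_compact_surjective_zorn_subset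
    (continuous_uliftUp.comp hf) (ULift.up_surjective.comp hsurj)
  refine ⟨E, hE, ?_, fun E₀ hne hcl himage => hmin E₀ hne hcl ?_⟩
  · rw [image_comp] at hEuniv
    rw [← preimage_image_eq (f '' E) ULift.up_injective, hEuniv, preimage_univ]
  · change ULift.up ∘ E.domRestrict f '' E₀ = univ
    rw [image_comp, himage, image_univ, ULift.up_surjective.range_eq]

theorem scattered_of_cleavable_over_scattered (X Y : Type*) [TopologicalSpace X]
    [TopologicalSpace Y] [CompactSpace X] [T2Space X] (hY : Scattered Y)
    (h : Cleavable X Y) : Scattered X := by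
  by_contra hX
  obtain ⟨R, hR, hinj, hsurj⟩ := exists_graph_onto_cantor hX
  have : CompactSpace R := isCompact_iff_compactSpace.1 hR.isCompact
  have hcont : Continuous fun r : R => r.1.2 := continuous_snd.comp continuous_subtype_val
  obtain ⟨E, _, hEuniv, hmin⟩ := exists_compact_image_eq_univ_minimal hcont fun z => by
    obtain ⟨r, hr, rfl⟩ := hsurj.symm.subset (mem_univ z)
    exact ⟨⟨r, hr⟩, rfl⟩
  obtain ⟨f, hf, hdisj⟩ := h {x | ∃ r : R, r.1.1 = x ∧ ∀ᶠ n in Filter.atTop, r.1.2 n = false}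
  let g : E → Y := fun e => f e.1.1.1
  have hg : Continuous g :=
    hf.comp (continuous_fst.comp (continuous_subtype_val.comp continuous_subtype_val))
  obtain ⟨r₀, hr₀, -⟩ := hEuniv.symm.subset (mem_univ fun _ => false)
  obtain ⟨_, ⟨r, rfl⟩, V, hV, hVy⟩ := hY (range g) ⟨_, ⟨r₀, hr₀⟩, rfl⟩
  have hrV : g r ∈ V := (hVy.symm.subset rfl).1
  have hclosed : IsClosed (g ⁻¹' V)ᶜ := (hV.preimage hg).isClosed_compl
  have hO : IsOpen (E.domRestrict (fun r : R => r.1.2) '' (g ⁻¹' V)ᶜ)ᶜ :=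
    (hclosed.isCompact.image (hcont.comp continuous_subtype_val)).isClosed.isOpen_compl
  have hOne := nonempty_compl.2 <|
    hmin (g ⁻¹' V)ᶜ (fun hs => hs.symm.subset (mem_univ r) hrV) hclosed
  have hfib : ∀ b : Bool, ∃ e : E, (∀ᶠ n in Filter.atTop, e.1.1.2 n = b) ∧ g e = g r :=
    fun b => by
      obtain ⟨z, hz, hzb⟩ := exists_mem_eventually_eq hO hOne b
      obtain ⟨e, he, rfl⟩ := hEuniv.symm.subset (mem_univ z)
      have heV : g ⟨e, he⟩ ∈ V := by_contra fun hn => hz ⟨⟨e, he⟩, hn, rfl⟩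
      exact ⟨⟨e, he⟩, hzb, hVy.subset ⟨heV, ⟨e, he⟩, rfl⟩⟩
  obtain ⟨e, he, hfe⟩ := hfib false
  obtain ⟨e', he', hfe'⟩ := hfib true
  refine (hdisj.subset ⟨⟨_, ⟨e.1, rfl, he⟩, hfe⟩, e'.1.1.1, ?_, hfe'⟩ : g r ∈ (∅ : Set Y))
  rintro ⟨q, hq, hqD⟩
  rw [hinj q.2 e'.1.2 hq] at hqD
  obtain ⟨n, hn, hn'⟩ := (hqD.and he').exists
  simp [hn] at hn'
end

section
/- Let α and β be ordinals whose cofinalities are both uncountable (Cardinal.aleph0 < Ordinal.cof α and Cardinal.aleph0 < Ordinal.cof β). Let L be the lexicographic sum (Set.Iic α) ⊕ₗ ((Set.Iio β)ᵒᵈ) with its linear order (a copy of the ordinal α+1 followed by a copy of β with the reversed order), equipped with a topology for which L is an order topology. Then for every ordinal γ, L is not cleavable over γ: there exists a subset A of L such that no continuous map f : L → Set.Iio γ satisfies f '' A ∩ f '' (L \ A) = ∅. -/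
open Set Topology

section WellOrder

open Filter Order
open scoped Cardinal

variable {a : Type*} [LinearOrder a]

theorem noMaxOrder_of_aleph0_lt_cof (ha : ℵ₀ < Order.cof a) : NoMaxOrder a := by
  have : Nonempty a := cof_ne_zero_iff.1 (Cardinal.aleph0_pos.trans ha).ne'
  exact (noTopOrder_iff_noMaxOrder a).1 (one_lt_cof_iff.1 (Cardinal.one_lt_aleph0.trans ha))

theorem bddAbove_range_nat_of_aleph0_lt_cof (ha : ℵ₀ < Order.cof a) (s : ℕ → a) :
    BddAbove (range s) := by
  refine .of_not_isCofinal fun h ↦ (cof_le h).not_gt (ha.trans_le' ?_)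
  simpa using Cardinal.mk_range_le_lift (f := s)

theorem IsClosed.isClub [TopologicalSpace a] [OrderTopology a] {s : Set a}
    (hs : IsClosed s) (hs' : IsCofinal s) : IsClub s where
  dirSupClosed _ ht ht₀ _ _ hx := closure_minimal ht hs (hx.mem_closure ht₀)
  isCofinal := hs'

theorem IsClub.exists_gt [NoMaxOrder a] {C : Set a} (hC : IsClub C) (x : a) :
    ∃ y ∈ C, x < y := by
  obtain ⟨z, hz⟩ := NoMaxOrder.exists_gt x
  obtain ⟨y, hy, hzy⟩ := hC.isCofinal z
  exact ⟨y, hy, hz.trans_le hzy⟩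

variable [WellFoundedLT a]

theorem exists_isLUB_range_nat (ha : ℵ₀ < Order.cof a) (s : ℕ → a) :
    ∃ x, IsLUB (range s) x := by
  obtain ⟨x, hx, hmin⟩ := WellFounded.has_min (wellFounded_lt (α := a)) _
    (bddAbove_range_nat_of_aleph0_lt_cof ha s)
  exact ⟨x, hx, fun y hy ↦ not_lt.1 (hmin y hy)⟩

/-- Any family of clubs admits a strictly increasing sequence whose supremum lies in all clubs
indexed by the sequence. -/
theorem exists_strictMono_isLUB_mem_club (ha : ℵ₀ < Order.cof a) {C : a → Set a}
    (hC : ∀ x, IsClub (C x)) (y : a) :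
    ∃ (s : ℕ → a) (x : a), StrictMono s ∧ IsLUB (range s) x ∧ (∀ n, y < s n) ∧
      ∀ n, x ∈ C (s n) := by
  have := noMaxOrder_of_aleph0_lt_cof ha
  obtain ⟨s, hys, hs⟩ := exists_seq_of_forall_finset_exists (fun x ↦ y < x)
    (fun x z ↦ x < z ∧ z ∈ C x) fun t _ ↦ by
      obtain ⟨m, -, hm⟩ := (insert y t).exists_max_image id ⟨y, by simp⟩
      have : Nonempty a := ⟨y⟩
      obtain ⟨z, hz, hmz⟩ := (IsClub.iInter_of_countable ha.ne'
        fun x : (insert y t : Finset a) ↦ hC x).exists_gt m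
      refine ⟨z, (hm y (by simp)).trans_lt hmz, fun x hx ↦
        ⟨(hm x (by simp [hx])).trans_lt hmz, ?_⟩⟩
      exact mem_iInter.1 hz ⟨x, by simp [hx]⟩
  have hmono : StrictMono s := fun m n h ↦ (hs m n h).1
  obtain ⟨x, hx⟩ := exists_isLUB_range_nat ha s
  refine ⟨s, x, hmono, hx, hys, fun n ↦ ?_⟩
  refine (hC (s n)).isLUB_mem (t := range fun k ↦ s (n + 1 + k)) ?_ (range_nonempty _) ?_
  · rintro _ ⟨k, rfl⟩
    exact (hs _ _ (by omega)).2
  · refine ⟨?_, fun b hb ↦ hx.2 ?_⟩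
    · rintro _ ⟨k, rfl⟩
      exact hx.1 ⟨_, rfl⟩
    · rintro _ ⟨k, rfl⟩
      exact (hmono.monotone (by omega)).trans (hb ⟨k, rfl⟩)

theorem exists_isStationary_compl (ha : ℵ₀ < Order.cof a) :
    ∃ T : Set a, IsStationary T ∧ IsStationary Tᶜ := by
  by_contra! h
  have hclub : ∀ T : Set a, IsStationary T → ∃ C, IsClub C ∧ C ⊆ T := fun T hT ↦ by
    obtain ⟨C, hC, hd⟩ := not_isStationary_iff.1 (h T hT)
    exact ⟨C, hC, by rwa [disjoint_compl_left_iff_subset] at hd⟩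
  have hladder : ∀ x : a, ∃ s : ℕ → a, (∃ t : ℕ → a, StrictMono t ∧ IsLUB (range t) x) →
      StrictMono s ∧ IsLUB (range s) x := fun x ↦ by
    by_cases hx : ∃ t : ℕ → a, StrictMono t ∧ IsLUB (range t) x
    · exact ⟨hx.choose, fun _ ↦ hx.choose_spec⟩
    · exact ⟨fun _ ↦ x, fun h ↦ (hx h).elim⟩
  choose s hs using hladder
  obtain ⟨y₀⟩ : Nonempty a := cof_ne_zero_iff.1 (Cardinal.aleph0_pos.trans ha).ne'
  by_cases hn : ∃ n, ∀ y, IsStationary {x | y ≤ s x n}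
  · obtain ⟨n, hn⟩ := hn
    choose C hC hCs using fun y ↦ hclub _ (hn y)
    obtain ⟨t, x, ht, hx, -, hxC⟩ := exists_strictMono_isLUB_mem_club ha hC y₀
    obtain ⟨hmono, hlub⟩ := hs x ⟨t, ht, hx⟩
    have hle : x ≤ s x n := hx.2 (by rintro _ ⟨k, rfl⟩; exact hCs _ (hxC k))
    exact (hle.trans_lt (hmono n.lt_succ_self)).not_ge (hlub.1 ⟨_, rfl⟩)
  · push Not at hn
    choose y hy using hn
    choose C hC hCd using fun n ↦ not_isStationary_iff.1 (hy n)
    obtain ⟨b, hb⟩ := bddAbove_range_nat_of_aleph0_lt_cof ha y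
    obtain ⟨t, x, ht, hx, hbt, hxC⟩ :=
      exists_strictMono_isLUB_mem_club ha (fun _ ↦ IsClub.iInter_of_countable ha.ne' hC) b
    obtain ⟨hmono, hlub⟩ := hs x ⟨t, ht, hx⟩
    have hle : x ≤ b := hlub.2 (by
      rintro _ ⟨n, rfl⟩
      have hlt : s x n < y n := not_le.1 fun hle ↦
        (disjoint_left.1 (hCd n)) hle (mem_iInter.1 (hxC 0) n)
      exact hlt.le.trans (hb ⟨n, rfl⟩))
    exact ((hbt 0).trans_le (hx.1 ⟨0, rfl⟩)).not_ge hle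

theorem isCompact_Iic_of_wellFoundedLT [TopologicalSpace a] [OrderTopology a] (x : a) :
    IsCompact (Iic x) := by
  have : Nonempty a := ⟨x⟩
  let := WellFoundedLT.toOrderBot a
  let := WellFoundedLT.conditionallyCompleteLinearOrderBot a
  rw [← Icc_bot]
  exact isCompact_Icc

variable {b Z : Type*} [LinearOrder b] [WellFoundedLT b] [LinearOrder Z]
  [TopologicalSpace a] [OrderTopology a] [TopologicalSpace b] [OrderTopology b]
  [TopologicalSpace Z] [OrderTopology Z]

/-- Two continuous maps approaching the same point strictly from below have a common value above
any given point, obtained by interleaving. -/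
theorem exists_eq_of_tendsto_nhdsLT (ha : ℵ₀ < Order.cof a) (hb : ℵ₀ < Order.cof b)
    {F : a → Z} {G : b → Z} (hF : Continuous F) (hG : Continuous G) {d : Z}
    (hFd : Tendsto F atTop (𝓝[<] d)) (hGd : Tendsto G atTop (𝓝[<] d)) (y₀ : b) :
    ∃ y, y₀ ≤ y ∧ ∃ x, F x = G y := by
  have := noMaxOrder_of_aleph0_lt_cof ha
  have := noMaxOrder_of_aleph0_lt_cof hb
  have : Nonempty a := cof_ne_zero_iff.1 (Cardinal.aleph0_pos.trans ha).ne'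
  have : Nonempty b := ⟨y₀⟩
  have hF' := tendsto_nhdsWithin_iff.1 hFd
  have hG' := tendsto_nhdsWithin_iff.1 hGd
  obtain ⟨p, hp, hr⟩ := exists_seq_of_forall_finset_exists
    (fun p : a × b ↦ F p.1 < d ∧ G p.2 < d ∧ y₀ ≤ p.2)
    (fun p q ↦ p.1 < q.1 ∧ p.2 < q.2 ∧ F p.1 ≤ G q.2 ∧ G p.2 ≤ F q.1) fun t ht ↦ by
      have h₁ : ∀ᶠ x in atTop, ∀ p ∈ t, p.1 < x ∧ G p.2 < F x :=
        (t.eventually_all).2 fun p hp ↦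
          (eventually_gt_atTop _).and (hF'.1.eventually_const_lt (ht p hp).2.1)
      have h₂ : ∀ᶠ y in atTop, ∀ p ∈ t, p.2 < y ∧ F p.1 < G y :=
        (t.eventually_all).2 fun p hp ↦
          (eventually_gt_atTop _).and (hG'.1.eventually_const_lt (ht p hp).1)
      obtain ⟨x, hx, hx'⟩ := (h₁.and hF'.2).exists
      obtain ⟨y, hy, hy', hy''⟩ := (h₂.and (hG'.2.and (eventually_ge_atTop y₀))).exists
      exact ⟨(x, y), ⟨hx', hy', hy''⟩, fun p hp ↦
        ⟨(hx p hp).1, (hy p hp).1, (hy p hp).2.le, (hx p hp).2.le⟩⟩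
  have hm₁ : StrictMono fun n ↦ (p n).1 := fun m n h ↦ (hr m n h).1
  have hm₂ : StrictMono fun n ↦ (p n).2 := fun m n h ↦ (hr m n h).2.1
  obtain ⟨x, hx⟩ := exists_isLUB_range_nat ha fun n ↦ (p n).1
  obtain ⟨y, hy⟩ := exists_isLUB_range_nat hb fun n ↦ (p n).2
  have hFx : Tendsto (fun n ↦ F (p n).1) atTop (𝓝 (F x)) :=
    (hF.tendsto x).comp (tendsto_atTop_isLUB hm₁.monotone hx)
  have hGy : Tendsto (fun n ↦ G (p n).2) atTop (𝓝 (G y)) :=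
    (hG.tendsto y).comp (tendsto_atTop_isLUB hm₂.monotone hy)
  refine ⟨y, (hp 0).2.2.trans (hy.1 ⟨0, rfl⟩), x, le_antisymm ?_ ?_⟩
  · exact le_of_tendsto_of_tendsto' hFx (hGy.comp (tendsto_add_atTop_nat 1))
      fun n ↦ (hr n (n + 1) n.lt_succ_self).2.2.1
  · exact le_of_tendsto_of_tendsto' hGy (hFx.comp (tendsto_add_atTop_nat 1))
      fun n ↦ (hr n (n + 1) n.lt_succ_self).2.2.2

theorem IsStationary.exists_eq_of_tendsto_nhdsLT (ha : ℵ₀ < Order.cof a)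
    (hb : ℵ₀ < Order.cof b) {F : a → Z} {G : b → Z} (hF : Continuous F) (hG : Continuous G) {d : Z}
    (hFd : Tendsto F atTop (𝓝[<] d)) (hGd : Tendsto G atTop (𝓝[<] d)) {T : Set b}
    (hT : IsStationary T) : ∃ y ∈ T, ∃ x, F x = G y := by
  have : Nonempty a := cof_ne_zero_iff.1 (Cardinal.aleph0_pos.trans ha).ne'
  have : Nonempty b := cof_ne_zero_iff.1 (Cardinal.aleph0_pos.trans hb).ne'
  obtain ⟨y₀, hy₀⟩ := eventually_atTop.1 (tendsto_nhdsWithin_iff.1 hGd).2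
  have hF' := tendsto_nhdsWithin_iff.1 hFd
  have hclosed : IsClosed {y | y₀ ≤ y ∧ ∃ x, F x = G y} := by
    refine isClosed_of_closure_subset fun y hy ↦ ?_
    have hy₀y : y₀ ≤ y := closure_minimal (fun _ h ↦ h.1) isClosed_Ici hy
    obtain ⟨x₁, hx₁, hx₁d⟩ := ((hF'.1.eventually_const_lt (hy₀ y hy₀y)).and hF'.2).exists
    obtain ⟨x₀, hx₀⟩ := eventually_atTop.1 (hF'.1.eventually_const_lt hx₁d)
    have hcl : IsClosed (G ⁻¹' (F '' Iic x₀)) :=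
      ((isCompact_Iic_of_wellFoundedLT x₀).image hF).isClosed.preimage hG
    have hmem : y ∈ closure (G ⁻¹' (F '' Iic x₀)) := by
      have hfreq := (mem_closure_iff_frequently.1 hy).and_eventually
        (hG.continuousAt.eventually_lt_const hx₁)
      refine mem_closure_iff_frequently.2 (hfreq.mono ?_)
      rintro z ⟨⟨-, x, hx⟩, hz⟩
      refine ⟨x, ?_, hx⟩
      by_contra hlt
      exact (hx₀ x (not_le.1 hlt).le).not_gt (hx ▸ hz)
    obtain ⟨x, -, hx⟩ := hcl.closure_subset hmem
    exact ⟨hy₀y, x, hx⟩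
  obtain ⟨y, hyT, -, hy⟩ := hT <| hclosed.isClub fun z ↦ by
    obtain ⟨y, hy, hxy⟩ :=
      _root_.exists_eq_of_tendsto_nhdsLT ha hb hF hG hFd hGd (max y₀ z)
    exact ⟨y, ⟨(le_max_left _ _).trans hy, hxy⟩, (le_max_right _ _).trans hy⟩
  exact ⟨y, hyT, hy⟩

end WellOrder

theorem Ordinal.aleph0_lt_cof_Iio {α : Ordinal} (hα : Cardinal.aleph0 < α.cof) :
    Cardinal.aleph0 < Order.cof (Iio α) := by
  rw [Ordinal.cof_Iio, ← Ordinal.lift_cof]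
  exact Cardinal.aleph0_lt_lift.2 hα

theorem Ordinal.tendsto_nhdsLT_of_tendsto {ι : Type*} {l : Filter ι} {F : ι → Ordinal}
    {d : Ordinal} (hF : Filter.Tendsto F l (𝓝 d)) (hne : ∀ᶠ i in l, F i ≠ d) :
    Filter.Tendsto F l (𝓝[<] d) := by
  refine tendsto_nhdsWithin_iff.2 ⟨hF, ?_⟩
  filter_upwards [hne, hF.eventually_lt_const (Order.lt_succ d)] with i hi hi'
  exact (Order.lt_succ_iff.1 hi').lt_of_ne hi

section LexSum

variable {α β : Ordinal} [TopologicalSpace (Iic α ⊕ₗ (Iio β)ᵒᵈ)]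
  [OrderTopology (Iic α ⊕ₗ (Iio β)ᵒᵈ)]

theorem continuous_lexSum_inl :
    Continuous fun x : Iio α ↦ (Sum.inlₗ ⟨x, Iio_subset_Iic_self x.2⟩ : Iic α ⊕ₗ (Iio β)ᵒᵈ) := by
  refine (StrictMono.isEmbedding_of_ordConnected (fun x y h ↦ ?_) ⟨?_⟩).continuous
  · exact Sum.Lex.inl_lt_inl_iff.2 h
  · rintro _ ⟨x, rfl⟩ _ ⟨y, rfl⟩ (z | z) ⟨-, hz⟩
    · have hzy : z ≤ ⟨y, Iio_subset_Iic_self y.2⟩ := Sum.Lex.inl_le_inl_iff.1 hz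
      exact ⟨⟨z, mem_Iio.2 (lt_of_le_of_lt (Subtype.coe_le_coe.2 hzy) y.2)⟩, rfl⟩
    · exact (Sum.Lex.not_inr_le_inl hz).elim

theorem continuous_lexSum_inr :
    Continuous fun y : Iio β ↦ (Sum.inrₗ (OrderDual.toDual y) : Iic α ⊕ₗ (Iio β)ᵒᵈ) := by
  have hemb : IsEmbedding fun y : (Iio β)ᵒᵈ ↦ (Sum.inrₗ y : Iic α ⊕ₗ (Iio β)ᵒᵈ) := by
    refine StrictMono.isEmbedding_of_ordConnected (fun x y h ↦ ?_) ⟨?_⟩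
    · exact Sum.Lex.inr_lt_inr_iff.2 h
    · rintro _ ⟨x, rfl⟩ _ ⟨y, rfl⟩ (z | z) ⟨hz, -⟩
      · exact (Sum.Lex.not_inr_le_inl hz).elim
      · exact ⟨z, rfl⟩
  exact hemb.continuous.comp continuous_toDual

theorem tendsto_lexSum_inl (hα : Cardinal.aleph0 < α.cof) :
    Filter.Tendsto (fun x : Iio α ↦ (Sum.inlₗ ⟨x, Iio_subset_Iic_self x.2⟩ : Iic α ⊕ₗ (Iio β)ᵒᵈ)) Filter.atTop
      (𝓝 (Sum.inlₗ ⟨α, self_mem_Iic⟩)) := by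
  have := noMaxOrder_of_aleph0_lt_cof (Ordinal.aleph0_lt_cof_Iio hα)
  refine tendsto_order.2 ⟨?_, fun z hz ↦ .of_forall fun x ↦ lt_trans ?_ hz⟩
  · rintro (z | z) hz
    · have hz' : z < ⟨α, self_mem_Iic⟩ := Sum.Lex.inl_lt_inl_iff.1 hz
      filter_upwards [Filter.eventually_gt_atTop (⟨z, hz'⟩ : Iio α)] with x hx
      exact Sum.Lex.inl_lt_inl_iff.2 hx
    · exact (Sum.Lex.not_inr_lt_inl hz).elim
  · exact Sum.Lex.inl_lt_inl_iff.2 x.2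

theorem tendsto_lexSum_inr (hβ : Cardinal.aleph0 < β.cof) :
    Filter.Tendsto (fun y : Iio β ↦ (Sum.inrₗ (OrderDual.toDual y) : Iic α ⊕ₗ (Iio β)ᵒᵈ))
      Filter.atTop (𝓝 (Sum.inlₗ ⟨α, self_mem_Iic⟩)) := by
  have := noMaxOrder_of_aleph0_lt_cof (Ordinal.aleph0_lt_cof_Iio hβ)
  refine tendsto_order.2 ⟨fun z hz ↦ .of_forall fun x ↦ lt_trans hz ?_, ?_⟩
  · exact Sum.Lex.inl_lt_inr _ _
  · rintro (z | z) hz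
    · exact ((Sum.Lex.inl_lt_inl_iff.1 hz).not_ge z.2).elim
    · filter_upwards [Filter.eventually_gt_atTop (OrderDual.ofDual z)] with y hy
      exact Sum.Lex.inr_lt_inr_iff.2 hy

end LexSum

theorem not_cleavable_lex_sum (α β : Ordinal)
    (hα : Cardinal.aleph0 < Ordinal.cof α) (hβ : Cardinal.aleph0 < Ordinal.cof β)
    [TopologicalSpace (Set.Iic α ⊕ₗ (Set.Iio β)ᵒᵈ)]
    [OrderTopology (Set.Iic α ⊕ₗ (Set.Iio β)ᵒᵈ)] (γ : Ordinal) :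
    ∃ A : Set (Set.Iic α ⊕ₗ (Set.Iio β)ᵒᵈ),
      ∀ f : (Set.Iic α ⊕ₗ (Set.Iio β)ᵒᵈ) → Set.Iio γ,
        Continuous f → f '' A ∩ f '' Aᶜ ≠ ∅ := by
  have hα' := Ordinal.aleph0_lt_cof_Iio hα
  have hβ' := Ordinal.aleph0_lt_cof_Iio hβ
  obtain ⟨T, hT, hTc⟩ := exists_isStationary_compl hβ'
  let p : Iic α ⊕ₗ (Iio β)ᵒᵈ := Sum.inlₗ ⟨α, self_mem_Iic⟩
  let i (x : Iio α) : Iic α ⊕ₗ (Iio β)ᵒᵈ := Sum.inlₗ ⟨x, Iio_subset_Iic_self x.2⟩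
  let j (y : Iio β) : Iic α ⊕ₗ (Iio β)ᵒᵈ := Sum.inrₗ (OrderDual.toDual y)
  have hij : ∀ x y, i x ≠ j y := fun x y ↦ (Sum.Lex.inl_lt_inr _ _).ne
  have hj : Function.Injective j := fun x y h ↦ Sum.inr_injective h
  have hip : ∀ x, i x ≠ p := fun x ↦ (Sum.Lex.inl_lt_inl_iff.2 x.2).ne
  have hjp : ∀ y, j y ≠ p := fun y ↦ (Sum.Lex.inl_lt_inr _ _).ne'
  refine ⟨range i ∪ j '' T, fun f hf hdisj ↦ ?_⟩
  have hsep : ∀ u ∈ range i ∪ j '' T, ∀ v ∉ range i ∪ j '' T, (f u : Ordinal) ≠ f v :=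
    fun u hu v hv huv ↦ (hdisj ▸ notMem_empty (f u))
      ⟨mem_image_of_mem f hu, v, hv, Subtype.ext huv.symm⟩
  have hg : Continuous fun u ↦ (f u : Ordinal) := continuous_subtype_val.comp hf
  have hp : p ∉ range i ∪ j '' T := by
    rintro (⟨x, hx⟩ | ⟨y, -, hy⟩)
    exacts [hip x hx, hjp y hy]
  have hF : Continuous fun x ↦ (f (i x) : Ordinal) := hg.comp continuous_lexSum_inl
  have hG : Continuous fun y ↦ (f (j y) : Ordinal) := hg.comp continuous_lexSum_inr
  have hFp : Filter.Tendsto (fun x ↦ (f (i x) : Ordinal)) Filter.atTop (𝓝[<] (f p : Ordinal)) :=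
    Ordinal.tendsto_nhdsLT_of_tendsto ((hg.tendsto p).comp (tendsto_lexSum_inl hα))
      (.of_forall fun x ↦ hsep _ (.inl ⟨x, rfl⟩) _ hp)
  have hGne : ∀ᶠ y in Filter.atTop, (f (j y) : Ordinal) ≠ f p := by
    by_contra hfreq
    obtain ⟨y, hyT, hy⟩ := hT <|
      (isClosed_singleton.preimage hG : IsClosed {y | (f (j y) : Ordinal) = f p}).isClub
      fun z ↦ by
        obtain ⟨y, hzy, hy⟩ := (Filter.not_eventually.1 hfreq).forall_exists_of_atTop z
        exact ⟨y, not_not.1 hy, hzy⟩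
    exact hsep _ (.inr ⟨y, hyT, rfl⟩) _ hp hy
  have hGp : Filter.Tendsto (fun y ↦ (f (j y) : Ordinal)) Filter.atTop (𝓝[<] (f p : Ordinal)) :=
    Ordinal.tendsto_nhdsLT_of_tendsto ((hg.tendsto p).comp (tendsto_lexSum_inr hβ)) hGne
  obtain ⟨y, hy, x, hxy⟩ := hTc.exists_eq_of_tendsto_nhdsLT hα' hβ' hF hG hFp hGp
  refine hsep _ (.inl ⟨x, rfl⟩) (j y) ?_ hxy
  rintro (⟨x, hx⟩ | ⟨z, hz, hzy⟩)
  exacts [hij x y hx, hy (hj hzy ▸ hz)]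
end

section
/- Let X be an infinite compact Hausdorff topological space and let μ be the least ordinal over which X is cleavable: X is cleavable over μ, and for every ordinal ν < μ, X is not cleavable over ν. Then X is homeomorphic to an ordinal less than μ·ω: there exists an ordinal η < μ * ω (ordinal multiplication) such that X is homeomorphic to Set.Iio η. -/
open Set Topology

universe u v


theorem isClopen_Iic_ordinal (a : Ordinal.{v}) : IsClopen (Iic a) :=
  ⟨isClosed_Iic, by rw [← Order.Iio_succ]; exact isOpen_Iio⟩

theorem continuous_ordinal_iff {X : Type u} [TopologicalSpace X] {f : X → Ordinal.{v}} :
    Continuous f ↔ ∀ a, IsClopen (f ⁻¹' Iic a) := by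
  refine ⟨fun hf a => (isClopen_Iic_ordinal a).preimage hf, fun h => ?_⟩
  rw [OrderTopology.continuous_iff]
  refine fun a => ⟨?_, ?_⟩
  · rw [← compl_Iic, preimage_compl]
    exact (h a).compl.isOpen
  · have : Iio a = ⋃ b < a, Iic b := by
      ext c
      simp only [mem_Iio, mem_iUnion, mem_Iic, exists_prop]
      exact ⟨fun hc => ⟨c, hc, le_rfl⟩, fun ⟨b, hb, hc⟩ => hc.trans_lt hb⟩
    rw [this, preimage_iUnion₂]
    exact isOpen_biUnion fun b _ => (h b).isOpen

theorem continuousAt_ordinal_of_forall_lt {X : Type u} [TopologicalSpace X] {f : X → Ordinal.{v}}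
    {x : X} (hle : ∀ᶠ y in 𝓝 x, f y ≤ f x) (hlt : ∀ a < f x, ∀ᶠ y in 𝓝 x, a < f y) :
    ContinuousAt f x :=
  tendsto_order.2 ⟨hlt, fun _ ha => hle.mono fun _ hy => hy.trans_lt ha⟩

theorem IsCompact.exists_lt_forall_le {X : Type u} [TopologicalSpace X] {K : Set X}
    (hK : IsCompact K) {f : X → Ordinal.{v}} (hf : Continuous f) {a : Ordinal.{v}} (ha : 0 < a)
    (h : ∀ y ∈ K, f y < a) : ∃ b < a, ∀ y ∈ K, f y ≤ b := by
  rcases K.eq_empty_or_nonempty with rfl | hne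
  · exact ⟨0, ha, by simp⟩
  · obtain ⟨y, hy, hmax⟩ := hK.exists_isMaxOn hne hf.continuousOn
    exact ⟨f y, h y hy, hmax⟩

theorem exists_forall_lt_ordinal {X : Type u} [TopologicalSpace X] [CompactSpace X]
    {f : X → Ordinal.{v}} (hf : Continuous f) : ∃ M, ∀ y, f y < M := by
  obtain ⟨b, hb⟩ := (isCompact_range hf).bddAbove
  exact ⟨b + 1, fun y => Order.lt_add_one_iff.2 (hb (mem_range_self y))⟩

theorem exists_homeomorph_Iio {X : Type u} [TopologicalSpace X] [CompactSpace X]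
    {φ : X → Ordinal.{v}} (hφ : Continuous φ) (hinj : Function.Injective φ) :
    ∃ η : Ordinal.{v}, Nonempty (X ≃ₜ Iio η) := by
  obtain ⟨M, hM⟩ := exists_forall_lt_ordinal hφ
  set S := range φ ∪ Ici M
  have hS : ¬ BddAbove S := fun h => not_bddAbove_Ici M (h.mono subset_union_right)
  obtain ⟨η, hη⟩ := Ordinal.enumOrd_surjective hS (Or.inr self_mem_Ici : M ∈ S)
  choose j hj using fun x => Ordinal.enumOrd_surjective hS (Or.inl (mem_range_self x) : φ x ∈ S)
  have hjη : ∀ x, j x < η := fun x => by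
    rw [← Ordinal.enumOrd_lt_enumOrd hS, hj, hη]; exact hM x
  have hjc : Continuous j := by
    refine continuous_ordinal_iff.2 fun a => ?_
    have : j ⁻¹' Iic a = φ ⁻¹' Iic (Ordinal.enumOrd S a) := by
      ext x
      simp [← hj, Ordinal.enumOrd_le_enumOrd hS]
    rw [this]
    exact continuous_ordinal_iff.1 hφ _
  have hbij : Function.Bijective fun x => (⟨j x, hjη x⟩ : Iio η) := by
    refine ⟨fun x y hxy => hinj ?_, fun ⟨a, ha⟩ => ?_⟩
    · have h : j x = j y := congrArg Subtype.val hxy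
      rw [← hj x, ← hj y, h]
    · rcases Ordinal.enumOrd_mem hS a with ⟨x, hx⟩ | h
      · exact ⟨x, Subtype.ext (Ordinal.enumOrd_injective hS ((hj x).trans hx))⟩
      · exact absurd h (by
          rw [mem_Ici, ← hη, Ordinal.enumOrd_le_enumOrd hS]; exact (mem_Iio.1 ha).not_ge)
  exact ⟨η, ⟨Continuous.homeoOfEquivCompactToT2 (f := Equiv.ofBijective _ hbij)
    (hjc.subtype_mk _)⟩⟩

/-- Some continuous ordinal-valued function on the whole space is injective on `K`. -/
def InjectsInOrdinals {X : Type u} [TopologicalSpace X] (K : Set X) : Prop :=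
  ∃ φ : X → Ordinal.{v}, Continuous φ ∧ InjOn φ K

theorem InjectsInOrdinals.mono {X : Type u} [TopologicalSpace X] {K L : Set X}
    (h : InjectsInOrdinals.{u, v} L) (hKL : K ⊆ L) : InjectsInOrdinals.{u, v} K :=
  let ⟨φ, hφ, hinj⟩ := h
  ⟨φ, hφ, hinj.mono hKL⟩

theorem Set.Subsingleton.injectsInOrdinals {X : Type u} [TopologicalSpace X] {K : Set X}
    (h : K.Subsingleton) : InjectsInOrdinals.{u, v} K :=
  ⟨fun _ => 0, continuous_const, h.injOn _⟩

theorem mul_add_inj_of_lt {θ a b r s : Ordinal.{v}} (hr : r < θ) (hs : s < θ)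
    (h : θ * a + r = θ * b + s) : a = b ∧ r = s := by
  have hlt : ∀ {a b r s : Ordinal.{v}}, r < θ → a < b → θ * a + r < θ * b + s := by
    intro a b r s hr hab
    calc θ * a + r < θ * a + θ := by gcongr
      _ = θ * (a + 1) := by rw [mul_add, mul_one]
      _ ≤ θ * b := by gcongr; exact Order.add_one_le_of_lt hab
      _ ≤ θ * b + s := le_self_add
  obtain rfl : a = b := by
    rcases lt_trichotomy a b with hab | hab | hab
    · exact absurd h (hlt hr hab).ne
    · exact hab
    · exact absurd h (hlt hs hab).ne'
  exact ⟨rfl, add_left_cancel h⟩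

/-- Ordinals containing the fibres of a continuous map can be laid end to end. -/
theorem injectsInOrdinals_of_fibers {X : Type u} [TopologicalSpace X] [CompactSpace X] {K : Set X}
    {g : X → Ordinal.{v}} (hg : Continuous g)
    (hlim : ∀ y z, Order.IsSuccLimit (g y) → g z = g y → z = y)
    (hK : ∀ γ, ¬ Order.IsSuccLimit γ → InjectsInOrdinals.{u, v} (K ∩ g ⁻¹' {γ})) :
    InjectsInOrdinals.{u, v} K := by
  have hψ : ∀ γ, ∃ ψ : X → Ordinal.{v}, Continuous ψ ∧ InjOn ψ (K ∩ g ⁻¹' {γ}) ∧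
      (Order.IsSuccLimit γ → ψ = 0) := by
    intro γ
    by_cases hγ : Order.IsSuccLimit γ
    · refine ⟨0, continuous_const, ?_, fun _ => rfl⟩
      rintro y ⟨-, rfl⟩ z ⟨-, hz⟩ -
      exact (hlim y z hγ hz).symm
    · obtain ⟨ψ, h1, h2⟩ := hK γ hγ
      exact ⟨ψ, h1, h2, fun h => absurd h hγ⟩
  choose ψ hψc hψi hψ0 using hψ
  choose b hb using fun γ => exists_forall_lt_ordinal (hψc γ)
  obtain ⟨N, hN⟩ := exists_forall_lt_ordinal hg
  obtain ⟨θ, hθ⟩ : ∃ θ, ∀ y, ψ (g y) y < θ := by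
    obtain ⟨θ, hθ⟩ : BddAbove (b '' Iio N) := Ordinal.bddAbove_of_small
    exact ⟨θ, fun y => (hb _ y).trans_le (hθ (mem_image_of_mem b (hN y)))⟩
  refine ⟨fun y => θ * g y + ψ (g y) y, continuous_iff_continuousAt.2 fun y => ?_, ?_⟩
  · by_cases hy : Order.IsSuccLimit (g y)
    · have h0 : ψ (g y) y = 0 := by rw [hψ0 _ hy]; rfl
      refine continuousAt_ordinal_of_forall_lt ?_ fun a ha => ?_
      · filter_upwards [(continuous_ordinal_iff.1 hg (g y)).isOpen.mem_nhds
            (le_refl (g y) : y ∈ g ⁻¹' Iic (g y))] with z hz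
        rcases eq_or_lt_of_le (show g z ≤ g y from hz) with h | h
        · rw [hlim y z hy h]
        · calc θ * g z + ψ (g z) z ≤ θ * g z + θ := by gcongr; exact (hθ z).le
            _ = θ * (g z + 1) := by rw [mul_add, mul_one]
            _ ≤ θ * g y := by gcongr; exact Order.add_one_le_of_lt h
            _ ≤ θ * g y + ψ (g y) y := le_self_add
      · simp only [h0, add_zero] at ha
        obtain ⟨c, hc, hac⟩ := (Ordinal.lt_mul_iff_of_isSuccLimit hy).1 ha
        filter_upwards [hg.continuousAt.eventually (lt_mem_nhds hc)] with z hz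
        exact hac.trans_le ((mul_le_mul_right hz.le θ).trans le_self_add)
    · have hopen : IsOpen (g ⁻¹' {g y}) :=
        (SuccOrder.isOpen_singleton_iff.2 hy).preimage hg
      refine (((Ordinal.isNormal_add_right (θ * g y)).continuous.comp
        (hψc (g y))).continuousAt).congr ?_
      filter_upwards [hopen.mem_nhds rfl] with z hz
      simp only [Function.comp_apply, show g z = g y from hz]
  · intro y hy z hz h
    obtain ⟨h1, h2⟩ := mul_add_inj_of_lt (hθ y) (hθ z) h
    exact hψi (g y) ⟨hy, rfl⟩ ⟨hz, h1.symm⟩ (by rw [h2, h1])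

theorem InjectsInOrdinals.union {X : Type u} [TopologicalSpace X] [CompactSpace X] {K L : Set X}
    (hKc : IsClopen K) (hK : InjectsInOrdinals.{u, v} K) (hL : InjectsInOrdinals.{u, v} L) :
    InjectsInOrdinals.{u, v} (K ∪ L) := by
  classical
  let g : X → Ordinal.{v} := fun y => if y ∈ K then 0 else 1
  have hg : Continuous g := continuous_const.if (by simp [hKc.frontier_eq]) continuous_const
  refine injectsInOrdinals_of_fibers hg (fun y z hy => ?_) fun γ _ => ?_
  · have h1 : ¬ Order.IsSuccLimit (1 : Ordinal.{v}) := by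
      simpa using Order.not_isSuccLimit_succ (0 : Ordinal.{v})
    by_cases h : y ∈ K
    · simp [g, h] at hy
    · exact absurd (by simpa [g, h] using hy) h1
  · by_cases hγ : γ = 0
    · refine hK.mono fun y hy => ?_
      by_contra h
      simp [g, h, hγ] at hy
    · refine hL.mono fun y hy => hy.1.resolve_left fun h => ?_
      have := hy.2
      simp [g, h] at this
      exact hγ this.symm

/-- `f` takes no common value on `A` and on its complement. -/
def Cleaves {X : Type u} (f : X → Ordinal.{v}) (A : Set X) : Prop :=
  ∀ y ∈ A, ∀ z ∉ A, f y ≠ f z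

theorem exists_cleaves_forall_le {X : Type u} [TopologicalSpace X] [CompactSpace X]
    (H : ∀ A : Set X, ∃ f : X → Ordinal.{v}, Continuous f ∧ Cleaves f A) (A : Set X) (x : X) :
    ∃ f : X → Ordinal.{v}, Continuous f ∧ Cleaves f A ∧ ∀ y, f y ≤ f x := by
  classical
  obtain ⟨f, hf, hA⟩ := H A
  obtain ⟨M, hM⟩ := exists_forall_lt_ordinal hf
  have hlt : ∀ y z, f y < M + f z := fun y z => (hM y).trans_le le_self_add
  refine ⟨fun y => if f y ≤ f x then M + f y else f y, ?_, fun y hy z hz => ?_, fun y => ?_⟩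
  · refine ((Ordinal.isNormal_add_right M).continuous.comp hf).if (fun y hy => ?_) hf
    have hc : IsClopen {y | f y ≤ f x} := (isClopen_Iic_ordinal (f x)).preimage hf
    rw [hc.frontier_eq] at hy
    exact hy.elim
  · have := hA y hy z hz
    dsimp only
    split_ifs
    · simpa using this
    · exact (hlt z y).ne'
    · exact (hlt y z).ne
    · exact this
  · dsimp only
    rw [if_pos le_rfl]
    split_ifs with h
    · gcongr
    · exact (hlt y x).le

theorem exists_lt_forall_mem_of_isOpen {X : Type u} [TopologicalSpace X] [CompactSpace X]
    {f : X → Ordinal.{v}} (hf : Continuous f) {x : X} (hle : ∀ y, f y ≤ f x)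
    (hx : ∀ y, f y = f x → y = x) (h0 : 0 < f x) {U : Set X} (hU : IsOpen U) (hxU : x ∈ U) :
    ∃ δ < f x, ∀ y, δ < f y → y ∈ U := by
  obtain ⟨δ, hδ, h⟩ := hU.isClosed_compl.isCompact.exists_lt_forall_le hf h0 fun y hy =>
    (hle y).lt_of_ne fun h => hy (hx y h ▸ hxU)
  exact ⟨δ, hδ, fun y hy => by_contra fun hyU => (h y hyU).not_gt hy⟩

/-- A function into `l` from a smaller ordinal is bounded in `l`. -/
def BoundsShort (l : Ordinal.{v}) : Prop :=
  ∀ δ < l, ∀ τ : Ordinal.{v} → Ordinal.{v}, (∀ ε < δ, τ ε < l) → ∃ θ < l, ∀ ε < δ, τ ε ≤ θ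

theorem exists_lt_continuous_of_not_boundsShort {l : Ordinal.{v}} (hl : ¬ BoundsShort l) :
    ∃ δ < l, ∃ r : Ordinal.{v} → Ordinal.{v}, Continuous r ∧ (∀ γ, r γ ≤ δ) ∧
      ∀ γ, r γ = δ ↔ l ≤ γ := by
  have hex : ∃ δ < l, ∃ τ : Ordinal.{v} → Ordinal.{v}, (∀ ε < δ, τ ε < l) ∧
      ∀ θ < l, ∃ ε < δ, θ < τ ε := by
    unfold BoundsShort at hl
    push Not at hl
    exact hl
  obtain ⟨δ, ⟨hδ, τ, hτ, hτu⟩, hmin⟩ := WellFounded.has_min Ordinal.lt_wf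
    {δ | δ < l ∧ ∃ τ : Ordinal.{v} → Ordinal.{v}, (∀ ε < δ, τ ε < l) ∧
      ∀ θ < l, ∃ ε < δ, θ < τ ε} hex
  have hbdd : ∀ ε, BddAbove (τ '' Iic ε) := fun ε => Ordinal.bddAbove_of_small
  let T : Ordinal.{v} → Ordinal.{v} := fun ε => sSup (τ '' Iic ε)
  have hTτ : ∀ ε, τ ε ≤ T ε := fun ε => le_csSup (hbdd ε) (mem_image_of_mem τ self_mem_Iic)
  have hTmono : Monotone T := fun a b hab =>
    csSup_le_csSup (hbdd b) (nonempty_Iic.image τ) (image_mono (Iic_subset_Iic.2 hab))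
  have hTlt : ∀ ε < δ, T ε < l := by
    intro ε hε
    have : ∃ θ < l, ∀ ε' < ε, τ ε' ≤ θ := by
      by_contra! h
      exact hmin ε ⟨hε.trans hδ, τ, fun ε' h' => hτ ε' (h'.trans hε), h⟩ hε
    obtain ⟨θ, hθ, hθ'⟩ := this
    refine (csSup_le (nonempty_Iic.image τ) ?_ : T ε ≤ max θ (τ ε)).trans_lt
      (max_lt hθ (hτ ε hε))
    rintro _ ⟨ε', h', rfl⟩
    rcases eq_or_lt_of_le (mem_Iic.1 h') with rfl | h'
    · exact le_max_right _ _
    · exact (hθ' ε' h').trans (le_max_left _ _)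
  let r : Ordinal.{v} → Ordinal.{v} := fun γ => sInf {ε | ε = δ ∨ γ ≤ T ε}
  have hrδ : ∀ γ, r γ ≤ δ := fun γ => csInf_le' (Or.inl rfl)
  have hr : ∀ γ ε, ε < δ → (r γ ≤ ε ↔ γ ≤ T ε) := by
    intro γ ε hε
    refine ⟨fun h => ?_, fun h => csInf_le' (Or.inr h)⟩
    rcases (csInf_mem ⟨δ, Or.inl rfl⟩ : r γ ∈ {ε | ε = δ ∨ γ ≤ T ε}) with h' | h'
    · exact absurd hε (h'.symm.le.trans h).not_gt
    · exact h'.trans (hTmono h)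
  refine ⟨δ, hδ, r, continuous_ordinal_iff.2 fun ε => ?_, hrδ, fun γ => ⟨fun h => ?_, fun h => ?_⟩⟩
  · rcases lt_or_ge ε δ with hε | hε
    · rw [show r ⁻¹' Iic ε = Iic (T ε) from Set.ext fun γ => hr γ ε hε]
      exact isClopen_Iic_ordinal _
    · rw [show r ⁻¹' Iic ε = univ from eq_univ_of_forall fun γ => (hrδ γ).trans hε]
      exact isClopen_univ
  · by_contra! hγ
    obtain ⟨ε, hε, h'⟩ := hτu γ hγ
    exact hε.not_ge (h ▸ (hr γ ε hε).2 (h'.le.trans (hTτ ε)))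
  · refine (hrδ γ).antisymm (le_of_not_gt fun h' => ?_)
    exact (((hr γ _ h').1 le_rfl).trans_lt (hTlt _ h')).not_ge h

theorem exists_peak_boundsShort {X : Type u} [TopologicalSpace X] [CompactSpace X]
    (H : ∀ A : Set X, ∃ f : X → Ordinal.{v}, Continuous f ∧ Cleaves f A) (x : X) :
    ∃ f : X → Ordinal.{v}, Continuous f ∧ (∀ y, f y ≤ f x) ∧ (∀ y, f y = f x → y = x) ∧
      BoundsShort (f x) := by
  obtain ⟨f₀, hf₀, hA₀, hle₀⟩ := exists_cleaves_forall_le H {x} x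
  obtain ⟨l, ⟨f, hf, hle, hx, rfl⟩, hmin⟩ := WellFounded.has_min Ordinal.lt_wf
    {l | ∃ f : X → Ordinal.{v}, Continuous f ∧ (∀ y, f y ≤ f x) ∧ (∀ y, f y = f x → y = x) ∧
      f x = l} ⟨f₀ x, f₀, hf₀, hle₀, fun y hy => by_contra fun h => hA₀ x rfl y h hy.symm, rfl⟩
  refine ⟨f, hf, hle, hx, by_contra fun hl => ?_⟩
  obtain ⟨δ, hδ, r, hr, hrle, hreq⟩ := exists_lt_continuous_of_not_boundsShort hl
  have hrx : r (f x) = δ := (hreq _).2 le_rfl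
  refine hmin δ ⟨r ∘ f, hr.comp hf, fun y => ?_, fun y hy => ?_, hrx⟩ hδ
  · simpa [hrx] using hrle (f y)
  · exact hx y ((hle y).antisymm ((hreq _).1 (hy.trans hrx)))

/-- A closed set `C` of ordinals is the range, up to non-limit values, of a continuous map that
fixes the limit points of `C`. -/
theorem exists_continuous_isSuccLimit_mem {C : Set Ordinal.{v}}
    (hC : ∀ δ, Order.IsSuccLimit δ → (∀ θ < δ, ∃ c ∈ C, θ ≤ c ∧ c < δ) → δ ∈ C) :
    ∃ r : Ordinal.{v} → Ordinal.{v}, Continuous r ∧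
      (∀ γ, Order.IsSuccLimit (r γ) → r γ ∈ C) ∧
      (∀ γ, Order.IsSuccLimit (r γ) → r γ = γ) ∧
      ∀ γ, (∀ θ < γ, ∃ c ∈ C, θ ≤ c ∧ c < γ) → r γ = γ := by
  let r : Ordinal.{v} → Ordinal.{v} := fun γ => sSup (Order.succ '' (C ∩ Iio γ))
  have hbdd : ∀ γ, BddAbove (Order.succ '' (C ∩ Iio γ)) := fun γ => by
    refine ⟨γ, ?_⟩
    rintro _ ⟨c, hc, rfl⟩
    exact Order.succ_le_of_lt hc.2
  have hr : ∀ γ a, r γ ≤ a ↔ ∀ c ∈ C, c < γ → c < a := by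
    intro γ a
    rw [csSup_le_iff' (hbdd γ)]
    simp only [forall_mem_image, Order.succ_le_iff]
    exact ⟨fun h c hc h' => h ⟨hc, h'⟩, fun h c hc => h c hc.1 hc.2⟩
  have hrγ : ∀ γ, r γ ≤ γ := fun γ => (hr γ γ).2 fun _ _ h => h
  have hacc : ∀ γ, Order.IsSuccLimit (r γ) → ∀ θ < r γ, ∃ c ∈ C, θ ≤ c ∧ c < r γ := by
    intro γ hγ θ hθ
    have := (hr γ θ).not.1 hθ.not_ge
    push Not at this
    obtain ⟨c, hc, hcγ, hθc⟩ := this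
    exact ⟨c, hc, hθc, Order.succ_le_iff.1
      (le_csSup (hbdd γ) (mem_image_of_mem _ (⟨hc, hcγ⟩ : c ∈ C ∩ Iio γ)))⟩
  have hmem : ∀ γ, Order.IsSuccLimit (r γ) → r γ ∈ C := fun γ hγ =>
    hC _ hγ (hacc γ hγ)
  refine ⟨r, continuous_ordinal_iff.2 fun a => ?_, hmem, fun γ hγ => ?_, fun γ h => ?_⟩
  · by_cases ha : ∃ c ∈ C, a ≤ c
    · have hm : sInf {c | c ∈ C ∧ a ≤ c} ∈ {c | c ∈ C ∧ a ≤ c} := csInf_mem ha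
      have : r ⁻¹' Iic a = Iic (sInf {c | c ∈ C ∧ a ≤ c}) := by
        ext γ
        rw [mem_preimage, mem_Iic, hr, mem_Iic]
        refine ⟨fun h => le_of_not_gt fun h' => (h _ hm.1 h').not_ge hm.2, fun h c hc hcγ => ?_⟩
        by_contra! hac
        exact (hcγ.trans_le h).not_ge (csInf_le' ⟨hc, hac⟩)
      rw [this]
      exact isClopen_Iic_ordinal _
    · push Not at ha
      rw [show r ⁻¹' Iic a = univ from
        eq_univ_of_forall fun γ => (hr γ a).2 fun c hc _ => ha c hc]
      exact isClopen_univ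
  · refine (hrγ γ).antisymm (le_of_not_gt fun h => ?_)
    exact lt_irrefl _ ((hr γ (r γ)).1 le_rfl _ (hmem γ hγ) h)
  · refine (hrγ γ).antisymm (le_of_not_gt fun h' => ?_)
    obtain ⟨c, hc, h1, h2⟩ := h _ h'
    exact ((hr γ (r γ)).1 le_rfl c hc h2).not_ge h1

theorem exists_mem_closure_eq_of_forall_lt {X : Type u} [TopologicalSpace X] [CompactSpace X]
    {f : X → Ordinal.{v}} (hf : Continuous f) {δ : Ordinal.{v}} (h0 : 0 < δ)
    (h : ∀ ρ < δ, ∃ y, ρ < f y ∧ f y < δ) : ∃ a ∈ closure (f ⁻¹' Iio δ), f a = δ := by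
  by_contra! hne
  have hle : closure (f ⁻¹' Iio δ) ⊆ f ⁻¹' Iic δ :=
    closure_minimal (preimage_mono Iio_subset_Iic_self) (isClosed_Iic.preimage hf)
  obtain ⟨b, hb, hb'⟩ := isClosed_closure.isCompact.exists_lt_forall_le hf h0
    fun y hy => (hle hy).lt_of_ne (hne y hy)
  obtain ⟨y, hy, hy'⟩ := h b hb
  exact (hb' y (subset_closure hy')).not_gt hy

theorem exists_lt_lt_of_not_isOpen {X : Type u} [TopologicalSpace X] {f : X → Ordinal.{v}}
    (hf : Continuous f) {x : X} (hle : ∀ y, f y ≤ f x) (hx : ∀ y, f y = f x → y = x)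
    (hxo : ¬ IsOpen {x}) {ρ : Ordinal.{v}} (hρ : ρ < f x) : ∃ y, ρ < f y ∧ f y < f x := by
  by_contra! h
  refine hxo ?_
  have : f ⁻¹' Ioi ρ = {x} := by
    ext y
    exact ⟨fun hy => hx y ((hle y).antisymm (h y hy)), fun hy => by rwa [mem_singleton_iff.1 hy]⟩
  rw [← this]
  exact isOpen_Ioi.preimage hf

theorem isSuccLimit_of_not_isOpen {X : Type u} [TopologicalSpace X] {f : X → Ordinal.{v}}
    (hf : Continuous f) {x : X} (hle : ∀ y, f y ≤ f x) (hx : ∀ y, f y = f x → y = x)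
    (hxo : ¬ IsOpen {x}) : Order.IsSuccLimit (f x) := by
  refine ⟨fun h => hxo ?_, fun ρ hρ => ?_⟩
  · rw [show ({x} : Set X) = univ from
      eq_univ_of_forall fun y => hx y ((hle y).antisymm (h (hle y)))]
    exact isOpen_univ
  · obtain ⟨y, h1, h2⟩ := exists_lt_lt_of_not_isOpen hf hle hx hxo hρ.lt
    exact hρ.2 h1 h2

theorem exists_lt_forall_nat_le {l : Ordinal.{v}}
    (hl : ∀ τ : Ordinal.{v} → Ordinal.{v}, (∀ ε < Ordinal.omega0, τ ε < l) →
      ∃ θ < l, ∀ ε < Ordinal.omega0, τ ε ≤ θ) {u : ℕ → Ordinal.{v}} (hu : ∀ n, u n < l) :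
    ∃ θ < l, ∀ n, u n ≤ θ := by
  obtain ⟨θ, hθ, h⟩ := hl (fun ε => u (Cardinal.toNat ε.card)) fun _ _ => hu _
  exact ⟨θ, hθ, fun n => by simpa using h n (Ordinal.natCast_lt_omega0 n)⟩

/-- The values below `l` that `f` attains as limits of smaller values. -/
def limitValues {X : Type u} [TopologicalSpace X] (f : X → Ordinal.{v}) (l : Ordinal.{v}) :
    Set Ordinal.{v} :=
  {γ | γ < l ∧ ∃ a ∈ closure (f ⁻¹' Iio γ), f a = γ}

/-- Two functions with maximum at the non-isolated point `x`, the first one with a sharp maximum of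
regular value, the second one cleaving off a choice `a` of limits of smaller values of the first. -/
structure CleavedPeak {X : Type u} [TopologicalSpace X] (f f' : X → Ordinal.{v})
    (a : Ordinal.{v} → X) (x : X) : Prop where
  continuous : Continuous f
  le : ∀ y, f y ≤ f x
  eq : ∀ y, f y = f x → y = x
  boundsShort : BoundsShort (f x)
  not_isOpen : ¬ IsOpen {x}
  omega0_lt : Ordinal.omega0 < f x
  map_choice : ∀ γ ∈ limitValues f (f x), f (a γ) = γ
  choice_mem : ∀ γ ∈ limitValues f (f x), a γ ∈ closure (f ⁻¹' Iio γ)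
  continuous' : Continuous f'
  le' : ∀ y, f' y ≤ f' x
  cleaves : Cleaves f' (insert x (a '' limitValues f (f x)))

namespace CleavedPeak

variable {X : Type u} [TopologicalSpace X] {f f' : X → Ordinal.{v}}
  {a : Ordinal.{v} → X} {x : X}

theorem eq_empty_of_isOpen (h : CleavedPeak f f' a x) {V : Set X} (hV : IsOpen V)
    (hVa : V ⊆ a '' limitValues f (f x)) : V = ∅ := by
  by_contra hne
  obtain ⟨y, hy, hmin⟩ := WellFounded.has_min (InvImage.wf f Ordinal.lt_wf) V
    (nonempty_iff_ne_empty.2 hne)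
  obtain ⟨γ, hγ, rfl⟩ := hVa hy
  obtain ⟨z, hzV, hz⟩ := mem_closure_iff.1 (h.choice_mem γ hγ) V hV hy
  exact hmin z hzV (by simpa [InvImage, h.map_choice γ hγ] using hz)

theorem mem_choice (h : CleavedPeak f f' a x) {y z : X}
    (hy : y ∈ insert x (a '' limitValues f (f x))) (hyz : f' z = f' y) (hz : f z < f x) :
    z ∈ a '' limitValues f (f x) := by
  have : z ∈ insert x (a '' limitValues f (f x)) :=
    by_contra fun hz' => h.cleaves y hy z hz' hyz.symm
  exact this.resolve_left fun h => hz.ne (h ▸ rfl)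

theorem exists_lt_lt (h : CleavedPeak f f' a x) {ρ : Ordinal.{v}} (hρ : ρ < f x) :
    ∃ y, ρ < f y ∧ f y < f x :=
  exists_lt_lt_of_not_isOpen h.continuous h.le h.eq h.not_isOpen hρ

theorem pos (h : CleavedPeak f f' a x) : 0 < f x :=
  Ordinal.omega0_pos.trans h.omega0_lt

theorem lt_of_lt' (h : CleavedPeak f f' a x) {y : X} (hy : f' y < f' x) : f y < f x :=
  (h.le y).lt_of_ne fun he => hy.ne (h.eq y he ▸ rfl)

theorem map_choice' (h : CleavedPeak f f' a x) {δ σ : Ordinal.{v}}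
    (hδ : δ ∈ limitValues f (f x)) (hδσ : ∀ y, f y < δ ↔ f' y < σ) : f' (a δ) = σ := by
  refine le_antisymm ?_ (le_of_not_gt fun hlt => ?_)
  · have hcl : closure (f ⁻¹' Iio δ) ⊆ f' ⁻¹' Iic σ :=
      closure_minimal (fun y hy => ((hδσ y).1 hy).le) (isClosed_Iic.preimage h.continuous')
    exact hcl (h.choice_mem δ hδ)
  · exact ((hδσ _).2 hlt).ne (h.map_choice δ hδ)

theorem eq_choice (h : CleavedPeak f f' a x) {δ σ : Ordinal.{v}} (hσ : σ < f' x)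
    (hδ : δ ∈ limitValues f (f x)) (hδσ : ∀ y, f y < δ ↔ f' y < σ) {z : X} (hz : f' z = σ) :
    z = a δ := by
  have haσ := h.map_choice' hδ hδσ
  have hmem : a δ ∈ insert x (a '' limitValues f (f x)) := Or.inr (mem_image_of_mem a hδ)
  have hzx : f z < f x := h.lt_of_lt' (hz ▸ hσ)
  have hW : f' ⁻¹' Iic σ ∩ f ⁻¹' Ioo δ (f x) = ∅ := by
    refine h.eq_empty_of_isOpen (((isClopen_Iic_ordinal σ).isOpen.preimage h.continuous').inter
      (isOpen_Ioo.preimage h.continuous)) fun w hw => h.mem_choice hmem ?_ hw.2.2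
    rw [haσ]
    exact le_antisymm hw.1 (le_of_not_gt fun hlt => ((hδσ w).2 hlt).not_gt hw.2.1)
  have hzδ : f z = δ := by
    refine le_antisymm (le_of_not_gt fun hlt => ?_) (le_of_not_gt fun hlt => ?_)
    · exact (hW ▸ (⟨hz.le, hlt, hzx⟩ : z ∈ f' ⁻¹' Iic σ ∩ f ⁻¹' Ioo δ (f x)) : z ∈ (∅ : Set X))
    · exact ((hδσ z).1 hlt).ne hz
  obtain ⟨γ, hγ, rfl⟩ := h.mem_choice hmem (hz.trans haσ.symm) hzx
  rw [← hzδ, h.map_choice γ hγ]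

/-- The values of `f'` up to its maximum that cut the space at the same place as a limit value
of `f`. -/
def commonCuts (f f' : X → Ordinal.{v}) (x : X) : Set Ordinal.{v} :=
  insert (f' x) {σ | σ < f' x ∧ ∃ δ ∈ limitValues f (f x), ∀ y, f y < δ ↔ f' y < σ}

variable [CompactSpace X]

theorem exists_lt_of_lt' (h : CleavedPeak f f' a x) {σ : Ordinal.{v}} (hσ : σ < f' x) :
    ∃ δ < f x, ∀ y, δ < f y → σ < f' y :=
  exists_lt_forall_mem_of_isOpen h.continuous h.le h.eq h.pos (isOpen_Ioi.preimage h.continuous') hσ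

theorem exists_bound' (h : CleavedPeak f f' a x) {δ : Ordinal.{v}} (hδ : δ < f x)
    {τ : Ordinal.{v} → Ordinal.{v}} (hτ : ∀ ε < δ, τ ε < f' x) :
    ∃ σ < f' x, ∀ ε < δ, τ ε ≤ σ := by
  have hρ : ∀ ε, ∃ ρ < f x, ε < δ → ∀ y, ρ < f y → τ ε < f' y := fun ε => by
    by_cases hε : ε < δ
    · obtain ⟨ρ, hρ, h'⟩ := h.exists_lt_of_lt' (hτ ε hε)
      exact ⟨ρ, hρ, fun _ => h'⟩
    · exact ⟨0, h.pos, fun h' => absurd h' hε⟩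
  choose ρ hρ hρτ using hρ
  obtain ⟨θ, hθ, hθρ⟩ := h.boundsShort δ hδ ρ fun ε _ => hρ ε
  by_contra! hcon
  have hV : f ⁻¹' Ioo θ (f x) = ∅ := by
    refine h.eq_empty_of_isOpen (isOpen_Ioo.preimage h.continuous) fun y hy => ?_
    refine h.mem_choice (mem_insert x _) ((h.le' y).antisymm (le_of_not_gt fun hlt => ?_)) hy.2
    obtain ⟨ε, hε, hlt'⟩ := hcon _ hlt
    exact (hρτ ε hε y ((hθρ ε hε).trans_lt hy.1)).not_gt hlt'
  obtain ⟨y, hy⟩ := h.exists_lt_lt hθ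
  exact (hV ▸ hy : y ∈ (∅ : Set X))

theorem pos' (h : CleavedPeak f f' a x) : 0 < f' x := by
  obtain ⟨σ, hσ, -⟩ := h.exists_bound' h.pos (τ := 0) fun ε hε => absurd hε not_lt_zero
  exact hσ.bot_lt

theorem exists_lt' (h : CleavedPeak f f' a x) {δ : Ordinal.{v}} (hδ : δ < f x) :
    ∃ σ < f' x, ∀ y, f y ≤ δ → f' y ≤ σ := by
  induction δ using WellFoundedLT.induction with
  | ind δ ih =>
    choose! τ hτ hτ' using ih
    obtain ⟨σ, hσ, hστ⟩ := h.exists_bound' hδ fun ε hε => hτ ε hε (hε.trans hδ)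
    have hcl : closure (f ⁻¹' Iio δ) ⊆ f' ⁻¹' Iic σ :=
      closure_minimal (fun y hy => (hτ' _ hy (lt_trans hy hδ) y le_rfl).trans (hστ _ hy))
        (isClosed_Iic.preimage h.continuous')
    have hlt : ∀ y ∈ f ⁻¹' Iic δ, f' y < f' x := by
      refine fun y hy => (h.le' y).lt_of_ne fun heq => ?_
      obtain ⟨γ, hγ, rfl⟩ := h.mem_choice (mem_insert x _) heq (lt_of_le_of_lt hy hδ)
      have hγδ : γ ≤ δ := by simpa [h.map_choice γ hγ] using hy
      have := hcl (closure_mono (preimage_mono (Iio_subset_Iio hγδ)) (h.choice_mem γ hγ))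
      exact (lt_of_le_of_lt this hσ).ne heq
    exact ((isClosed_Iic.preimage h.continuous).isCompact).exists_lt_forall_le h.continuous' h.pos' hlt

theorem eq' (h : CleavedPeak f f' a x) {y : X} (hy : f' y = f' x) : y = x := by
  by_contra hne
  obtain ⟨σ, hσ, h'⟩ := h.exists_lt' ((h.le y).lt_of_ne fun he => hne (h.eq y he))
  exact ((h' y le_rfl).trans_lt hσ).ne hy

theorem isSuccLimit' (h : CleavedPeak f f' a x) : Order.IsSuccLimit (f' x) :=
  isSuccLimit_of_not_isOpen h.continuous' h.le' (fun _ => h.eq') h.not_isOpen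

theorem eq_of_mem_commonCuts (h : CleavedPeak f f' a x) {y z : X} (hy : f' y ∈ commonCuts f f' x)
    (hyz : f' z = f' y) : z = y := by
  rcases hy with hy | ⟨hlt, δ, hδ, hδσ⟩
  · rw [h.eq' hy, h.eq' (hyz.trans hy)]
  · rw [h.eq_choice hlt hδ hδσ rfl, h.eq_choice hlt hδ hδσ hyz]

theorem mem_commonCuts_of_isSuccLimit (h : CleavedPeak f f' a x) {σ : Ordinal.{v}}
    (hσ : Order.IsSuccLimit σ) (hacc : ∀ θ < σ, ∃ c ∈ commonCuts f f' x, θ ≤ c ∧ c < σ) :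
    σ ∈ commonCuts f f' x := by
  rcases lt_trichotomy σ (f' x) with hlt | rfl | hgt
  · have hcut : ∀ θ < σ, ∃ c < σ, θ < c ∧ ∃ δ ∈ limitValues f (f x), ∀ y, f y < δ ↔ f' y < c := by
      intro θ hθ
      obtain ⟨c, hc, hθc, hcσ⟩ := hacc _ (hσ.succ_lt hθ)
      exact ⟨c, hcσ, Order.succ_le_iff.1 hθc, (hc.resolve_left (hcσ.trans hlt).ne).2⟩
    let Δ := {d | d ∈ limitValues f (f x) ∧ ∃ c < σ, ∀ y, f y < d ↔ f' y < c}
    have hΔ : BddAbove Δ := ⟨f x, fun d hd => hd.1.1.le⟩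
    have hΔlt : ∀ d ∈ Δ, ∃ d' ∈ Δ, d < d' := by
      rintro d ⟨hd, c, hc, hdc⟩
      obtain ⟨c', hc', hcc', d', hd', hdc'⟩ := hcut c hc
      refine ⟨d', ⟨hd', c', hc', hdc'⟩, ?_⟩
      rw [← h.map_choice d hd, hdc', h.map_choice' hd hdc]
      exact hcc'
    have hsup : ∀ y, f y < sSup Δ ↔ f' y < σ := by
      refine fun y => ⟨fun hy => ?_, fun hy => ?_⟩
      · obtain ⟨d, ⟨-, c, hc, hdc⟩, hyd⟩ := exists_lt_of_lt_csSup' hy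
        exact ((hdc y).1 hyd).trans hc
      · obtain ⟨c, hc, hyc, d, hd, hdc⟩ := hcut _ hy
        exact ((hdc y).2 hyc).trans_le (le_csSup hΔ ⟨hd, c, hc, hdc⟩)
    have hlt' : ∀ d ∈ Δ, d < sSup Δ := fun d hd => by
      obtain ⟨d', hd', h'⟩ := hΔlt d hd
      exact h'.trans_le (le_csSup hΔ hd')
    refine Or.inr ⟨hlt, sSup Δ, ⟨?_, ?_⟩, hsup⟩
    · obtain ⟨ρ, hρ, h'⟩ := h.exists_lt_of_lt' hlt
      obtain ⟨y, hy, hyx⟩ := h.exists_lt_lt hρ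
      exact (le_of_not_gt fun hy' => ((hsup y).1 hy').not_gt (h' y hy)).trans_lt hyx
    · refine exists_mem_closure_eq_of_forall_lt h.continuous ?_ fun ρ hρ => ?_
      · obtain ⟨c, hc, -, d, hd, hdc⟩ := hcut 0 hσ.bot_lt
        exact (hlt' d ⟨hd, c, hc, hdc⟩).bot_lt
      · obtain ⟨d, hd, hρd⟩ := exists_lt_of_lt_csSup' hρ
        refine ⟨a d, ?_⟩
        rw [h.map_choice d hd.1]
        exact ⟨hρd, hlt' d hd⟩
  · exact mem_insert _ _
  · obtain ⟨c, hc, hle, -⟩ := hacc _ (hσ.succ_lt hgt)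
    rcases hc with rfl | ⟨hc, -⟩
    · exact absurd (Order.succ_le_iff.1 hle) (lt_irrefl _)
    · exact absurd (Order.succ_le_iff.1 hle) hc.not_gt

theorem exists_mem_commonCuts (h : CleavedPeak f f' a x) {θ : Ordinal.{v}} (hθ : θ < f' x) :
    ∃ c ∈ commonCuts f f' x, θ ≤ c ∧ c < f' x := by
  have hstep : ∀ p : {p : Ordinal.{v} × Ordinal.{v} // p.1 < f x ∧ p.2 < f' x},
      ∃ q : {p : Ordinal.{v} × Ordinal.{v} // p.1 < f x ∧ p.2 < f' x},
        p.1.2 < q.1.2 ∧ (∀ y, f y ≤ p.1.1 → f' y < q.1.2) ∧ (∀ y, q.1.1 ≤ f y → p.1.2 < f' y) ∧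
          ∃ y, p.1.1 < f y ∧ f y < q.1.1 := by
    rintro ⟨⟨δ, σ⟩, hδ, hσ⟩
    obtain ⟨s, hs, hs'⟩ := h.exists_lt' hδ
    obtain ⟨d, hd, hd'⟩ := h.exists_lt_of_lt' hσ
    obtain ⟨y, hy, hyx⟩ := h.exists_lt_lt hδ
    have hl := isSuccLimit_of_not_isOpen h.continuous h.le h.eq h.not_isOpen
    refine ⟨⟨(max (Order.succ d) (Order.succ (f y)), max (Order.succ s) (Order.succ σ)),
      max_lt (hl.succ_lt hd) (hl.succ_lt hyx),
      max_lt (h.isSuccLimit'.succ_lt hs) (h.isSuccLimit'.succ_lt hσ)⟩, ?_, ?_, ?_, y, hy, ?_⟩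
    · exact (Order.lt_succ σ).trans_le (le_max_right _ _)
    · exact fun z hz => (Order.lt_succ_iff.2 (hs' z hz)).trans_le (le_max_left _ _)
    · exact fun z hz => hd' z (Order.succ_le_iff.1 ((le_max_left _ _).trans hz))
    · exact (Order.lt_succ _).trans_le (le_max_right _ _)
  choose step hstep₁ hstep₂ hstep₃ hstep₄ using hstep
  let p : ℕ → {p : Ordinal.{v} × Ordinal.{v} // p.1 < f x ∧ p.2 < f' x} := fun n =>
    step^[n] ⟨(0, θ), h.pos, hθ⟩
  have hp : ∀ n, p (n + 1) = step (p n) := fun n => Function.iterate_succ_apply' _ _ _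
  obtain ⟨δ, hδ, hδ'⟩ := exists_lt_forall_nat_le (h.boundsShort _ h.omega0_lt) fun n => (p n).2.1
  obtain ⟨σ, hσ, hσ'⟩ := exists_lt_forall_nat_le
    (fun τ => h.exists_bound' (τ := τ) h.omega0_lt) fun n => (p n).2.2
  have hb₁ : BddAbove (range fun n => (p n).1.1) := ⟨δ, forall_mem_range.2 hδ'⟩
  have hb₂ : BddAbove (range fun n => (p n).1.2) := ⟨σ, forall_mem_range.2 hσ'⟩
  have hlt : ⨆ n, (p n).1.1 < f x := (ciSup_le' hδ').trans_lt hδ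
  have hlt' : ⨆ n, (p n).1.2 < f' x := (ciSup_le' hσ').trans_lt hσ
  refine ⟨⨆ n, (p n).1.2, Or.inr ⟨hlt', ⨆ n, (p n).1.1, ⟨hlt, ?_⟩, fun y => ⟨fun hy => ?_,
    fun hy => ?_⟩⟩, le_ciSup hb₂ 0, hlt'⟩
  · have hy : ∀ n, ∃ y, (p n).1.1 < f y ∧ f y < ⨆ n, (p n).1.1 := fun n => by
      obtain ⟨y, hy, hy'⟩ := hstep₄ (p n)
      rw [← hp] at hy'
      exact ⟨y, hy, hy'.trans_le (le_ciSup hb₁ (n + 1))⟩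
    refine exists_mem_closure_eq_of_forall_lt h.continuous ?_ fun ρ hρ => ?_
    · obtain ⟨y, -, hy⟩ := hy 0
      exact hy.bot_lt
    · obtain ⟨n, hn⟩ := exists_lt_of_lt_ciSup' hρ
      obtain ⟨y, hy, hy'⟩ := hy n
      exact ⟨y, hn.trans hy, hy'⟩
  · obtain ⟨n, hn⟩ := exists_lt_of_lt_ciSup' hy
    have := hstep₂ (p n) y hn.le
    rw [← hp] at this
    exact this.trans_le (le_ciSup hb₂ (n + 1))
  · obtain ⟨n, hn⟩ := exists_lt_of_lt_ciSup' hy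
    refine lt_of_lt_of_le (lt_of_not_ge fun hle => ?_) (le_ciSup hb₁ (n + 1))
    exact (hstep₃ (p n) y (hp n ▸ hle)).not_gt hn

end CleavedPeak

theorem exists_continuous_isSuccLimit_injective {X : Type u} [TopologicalSpace X] [CompactSpace X]
    (H : ∀ A : Set X, ∃ f : X → Ordinal.{v}, Continuous f ∧ Cleaves f A) {x : X}
    (hxo : ¬ IsOpen {x}) :
    ∃ g : X → Ordinal.{v}, Continuous g ∧ (∀ y z, Order.IsSuccLimit (g y) → g z = g y → z = y) ∧
      Order.IsSuccLimit (g x) := by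
  obtain ⟨f, hf, hle, hx, hreg⟩ := exists_peak_boundsShort H x
  have hlim := isSuccLimit_of_not_isOpen hf hle hx hxo
  rcases (Ordinal.omega0_le_of_isSuccLimit hlim).eq_or_lt with hω | hω
  · refine ⟨f, hf, fun y z hy hz => ?_, hlim⟩
    have hy' := hx y ((hle y).antisymm (hω ▸ Ordinal.omega0_le_of_isSuccLimit hy))
    rw [hy', hx z (hz.trans (by rw [hy']))]
  have hex : ∀ γ, ∃ a, γ ∈ limitValues f (f x) → a ∈ closure (f ⁻¹' Iio γ) ∧ f a = γ := by
    intro γ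
    by_cases hγ : γ ∈ limitValues f (f x)
    · obtain ⟨a, h1, h2⟩ := hγ.2
      exact ⟨a, fun _ => ⟨h1, h2⟩⟩
    · exact ⟨x, fun h => absurd h hγ⟩
  choose a ha using hex
  obtain ⟨f', hf', hA, hle'⟩ := exists_cleaves_forall_le H (insert x (a '' limitValues f (f x))) x
  have h : CleavedPeak f f' a x := ⟨hf, hle, hx, hreg, hxo, hω, fun γ hγ => (ha γ hγ).2,
    fun γ hγ => (ha γ hγ).1, hf', hle', hA⟩
  obtain ⟨r, hr, hmem, hfix, hlimit⟩ := exists_continuous_isSuccLimit_mem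
    fun δ hδ => h.mem_commonCuts_of_isSuccLimit hδ
  refine ⟨r ∘ f', hr.comp hf', fun y z hy hz => ?_, ?_⟩
  · have hz' : r (f' z) = f' z := hfix _ ((show r (f' z) = r (f' y) from hz) ▸ hy)
    have hy' : r (f' y) = f' y := hfix _ hy
    exact h.eq_of_mem_commonCuts (hy' ▸ hmem _ hy) (hz'.symm.trans (hz.trans hy'))
  · have : r (f' x) = f' x := hlimit _ fun θ => h.exists_mem_commonCuts
    simpa [this] using h.isSuccLimit'

theorem mul_omega0_dvd_of_forall_lt {c v : Ordinal} (hc : 0 < c)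
    (h : ∀ θ < v, ∃ w < v, θ < w ∧ c ∣ w) : c * Ordinal.omega0 ∣ v := by
  have hv := Ordinal.div_add_mod v c
  have hr : v % c = 0 := by
    by_contra hr
    have hlt : c * (v / c) < v := by
      conv_rhs => rw [← hv]
      simpa using pos_iff_ne_zero.2 hr
    obtain ⟨_, hw, hw', q, rfl⟩ := h _ hlt
    have hq := (mul_lt_mul_iff_right₀ hc).1 hw'
    have h1 : c * (v / c + 1) ≤ c * q := by gcongr; exact Order.add_one_le_of_lt hq
    rw [mul_add, mul_one] at h1
    exact absurd (hw.trans (Ordinal.lt_mul_div_add v hc.ne')) h1.not_gt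
  rw [hr, add_zero] at hv
  rw [← hv]
  refine mul_dvd_mul_left _ (Ordinal.isSuccPrelimit_iff_omega0_dvd.1 fun p hp => ?_)
  obtain ⟨_, hw, hw', q, rfl⟩ := h (c * p) (by
    rw [← hv]; exact (mul_lt_mul_iff_right₀ hc).2 hp.lt)
  rw [← hv] at hw
  exact hp.2 ((mul_lt_mul_iff_right₀ hc).1 hw') ((mul_lt_mul_iff_right₀ hc).1 hw)

theorem opow_dvd_of_isSuccLimit {b r v : Ordinal} (hb : 0 < b) (hr : Order.IsSuccLimit r)
    (h : ∀ s < r, b ^ s ∣ v) : b ^ r ∣ v := by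
  rw [Ordinal.dvd_iff_mod_eq_zero]
  by_contra h0
  obtain ⟨s, hs, hlt⟩ := (Ordinal.lt_opow_of_isSuccLimit hb.ne' hr).1
    (Ordinal.mod_lt v (Ordinal.opow_pos r hb).ne')
  refine hlt.not_ge (Ordinal.le_of_dvd h0 ?_)
  rw [← Ordinal.dvd_add_iff ((Ordinal.opow_dvd_opow b hs.le).mul_right (v / b ^ r)),
    Ordinal.div_add_mod]
  exact h s hs

/-- Ordinals whose lowest nonzero term in Cantor normal form has a coefficient which is odd. -/
def oddLowest : Set Ordinal := {γ | ∃ e δ : Ordinal, γ = Ordinal.omega0 ^ e * (2 * δ + 1)}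

theorem two_mul_add_one_ne (a b : Ordinal) : (2 : Ordinal) * a + 1 ≠ 2 * b := by
  intro h
  have := congrArg (· % (2 : Ordinal)) h
  simp only [Ordinal.mul_add_mod_self, Ordinal.mul_mod] at this
  rw [Ordinal.mod_eq_of_lt (by exact_mod_cast one_lt_two)] at this
  exact one_ne_zero this

theorem opow_mul_add_two_notMem_oddLowest (s ξ : Ordinal) :
    Ordinal.omega0 ^ s * (2 * ξ + 2) ∉ oddLowest := by
  have key : ∀ {a b p q : Ordinal}, a < b →
      Ordinal.omega0 ^ a * (p + 1) ≠ Ordinal.omega0 ^ b * q := by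
    intro a b p q hab h
    rw [← Ordinal.add_sub_cancel_of_le hab.le, Ordinal.opow_add, mul_assoc] at h
    have h' := mul_left_cancel₀ (Ordinal.opow_pos a Ordinal.omega0_pos).ne' h
    have : Ordinal.omega0 ∣ p + 1 := by
      rw [h']
      refine Dvd.dvd.mul_right ?_ q
      simpa using Ordinal.opow_dvd_opow Ordinal.omega0
        (Order.one_le_iff_pos.2 (by simpa [pos_iff_ne_zero, Ordinal.sub_eq_zero_iff_le] using hab))
    exact Order.not_isSuccPrelimit_succ p
      (by simpa [Order.succ_eq_add_one] using Ordinal.isSuccPrelimit_iff_omega0_dvd.2 this)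
  rintro ⟨e, δ, h⟩
  have h2 : (2 : Ordinal) * ξ + 2 = 2 * ξ + 1 + 1 := by
    rw [add_assoc, one_add_one_eq_two]
  rcases lt_trichotomy s e with hse | rfl | hse
  · rw [h2] at h
    exact key hse h
  · have h' := mul_left_cancel₀ (Ordinal.opow_pos s Ordinal.omega0_pos).ne' h
    exact two_mul_add_one_ne δ (ξ + 1) (by rw [← h', mul_add, mul_one])
  · exact key hse h.symm

theorem exists_opposite_oddLowest {s γ θ : Ordinal} (hγ : γ ≠ 0)
    (hdvd : Ordinal.omega0 ^ (s + 1) ∣ γ) (hθ : θ < γ) :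
    ∃ γ' < γ, θ < γ' ∧ Ordinal.omega0 ^ s ∣ γ' ∧ ¬ (γ' ∈ oddLowest ↔ γ ∈ oddLowest) := by
  obtain ⟨δ, rfl⟩ := hdvd
  have hs : 0 < Ordinal.omega0 ^ s := Ordinal.opow_pos s Ordinal.omega0_pos
  rw [Ordinal.opow_add, Ordinal.opow_one, mul_assoc] at hγ hθ ⊢
  have hlim : Order.IsSuccLimit (Ordinal.omega0 * δ) :=
    (Order.isSuccLimit_iff _).2
      ⟨by simpa using right_ne_zero_of_mul hγ,
        Ordinal.isSuccPrelimit_iff_omega0_dvd.2 (dvd_mul_right _ _)⟩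
  obtain ⟨ζ, hζ, hθζ⟩ := (Ordinal.lt_mul_iff_of_isSuccLimit hlim).1 hθ
  set q := ζ / 2
  have hq : 2 * q ≤ ζ := Ordinal.mul_div_le ζ 2
  have hq' : ζ < 2 * q + 2 := Ordinal.lt_mul_div_add ζ two_ne_zero
  have h1 : 2 * q + 1 < Ordinal.omega0 * δ := hlim.add_one_lt (hq.trans_lt hζ)
  have h2 : 2 * q + 2 < Ordinal.omega0 * δ := by
    have := hlim.add_one_lt h1
    rwa [add_assoc, one_add_one_eq_two] at this
  have h3 : 2 * q + 2 + 1 < Ordinal.omega0 * δ := hlim.add_one_lt h2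
  by_cases hmem : Ordinal.omega0 ^ s * (Ordinal.omega0 * δ) ∈ oddLowest
  · refine ⟨Ordinal.omega0 ^ s * (2 * q + 2), (mul_lt_mul_iff_right₀ hs).2 h2,
      hθζ.trans ((mul_lt_mul_iff_right₀ hs).2 hq'), dvd_mul_right _ _, ?_⟩
    have := opow_mul_add_two_notMem_oddLowest s q
    tauto
  · refine ⟨Ordinal.omega0 ^ s * (2 * q + 2 + 1), (mul_lt_mul_iff_right₀ hs).2 h3,
      hθζ.trans ((mul_lt_mul_iff_right₀ hs).2 (hq'.trans (lt_add_one _))), dvd_mul_right _ _, ?_⟩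
    have : Ordinal.omega0 ^ s * (2 * q + 2 + 1) ∈ oddLowest :=
      ⟨s, q + 1, by rw [mul_add 2 q 1, mul_one]⟩
    tauto

theorem exists_opposite_value_near {η : Ordinal.{u}} {f : Iio η → Ordinal.{v}}
    (hf : Continuous f) (hcl : ∀ a b, ¬ (a.1 ∈ oddLowest ↔ b.1 ∈ oddLowest) → f a ≠ f b)
    {s : Ordinal.{u}} {γ : Iio η} (hγ : γ.1 ≠ 0) (hdvd : Ordinal.omega0 ^ (s + 1) ∣ γ.1)
    {θ : Ordinal.{v}} (hθ : θ < f γ) :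
    ∃ γ' : Iio η, γ'.1 ≠ 0 ∧ Ordinal.omega0 ^ s ∣ γ'.1 ∧ θ < f γ' ∧ f γ' < f γ := by
  have hU : f ⁻¹' (Ioi θ ∩ Iio (Order.succ (f γ))) ∈ 𝓝 γ :=
    (hf.isOpen_preimage _ (isOpen_Ioi.inter isOpen_Iio)).mem_nhds ⟨hθ, Order.lt_succ (f γ)⟩
  rw [nhds_subtype, Filter.mem_comap] at hU
  obtain ⟨t, ht, hsub⟩ := hU
  obtain ⟨l, hl, hlt⟩ := exists_Ioc_subset_of_mem_nhds ht ⟨0, pos_iff_ne_zero.2 hγ⟩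
  obtain ⟨γ', h1, h2, h3, h4⟩ := exists_opposite_oddLowest hγ hdvd hl
  have := @hsub ⟨γ', h1.trans γ.2⟩ (hlt ⟨h2, h1.le⟩)
  refine ⟨⟨γ', h1.trans γ.2⟩, (bot_le.trans_lt h2).ne', h3, this.1, ?_⟩
  exact (Order.lt_succ_iff.1 this.2).lt_of_ne (hcl _ _ h4)

theorem opow_dvd_value {η : Ordinal.{u}} {f : Iio η → Ordinal.{u}}
    (hf : Continuous f) (hcl : ∀ a b, ¬ (a.1 ∈ oddLowest ↔ b.1 ∈ oddLowest) → f a ≠ f b)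
    (r : Ordinal.{u}) : ∀ γ : Iio η, γ.1 ≠ 0 → Ordinal.omega0 ^ r ∣ γ.1 →
      Ordinal.omega0 ^ r ∣ f γ := by
  induction r using Ordinal.limitRecOn with
  | zero => simp
  | add_one s ih =>
    intro γ hγ hdvd
    rw [Ordinal.opow_add, Ordinal.opow_one]
    refine mul_omega0_dvd_of_forall_lt (Ordinal.opow_pos s Ordinal.omega0_pos) fun θ hθ => ?_
    obtain ⟨γ', h0, h1, h2, h3⟩ := exists_opposite_value_near hf hcl hγ hdvd hθ
    exact ⟨f γ', h3, h2, ih γ' h0 h1⟩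
  | limit r hr ih =>
    intro γ hγ hdvd
    exact opow_dvd_of_isSuccLimit Ordinal.omega0_pos hr fun s hs =>
      ih s hs γ hγ ((Ordinal.opow_dvd_opow _ hs.le).trans hdvd)

theorem lt_mul_omega0_of_cleavable {η μ : Ordinal.{u}} (hinf : Infinite (Iio η))
    [CompactSpace (Iio η)]
    (h : Cleavable (Iio η) (Iio μ)) : η < μ * Ordinal.omega0 := by
  obtain ⟨f, hf, hfA⟩ := h {γ | γ.1 ∈ oddLowest}
  have hne : ∀ a b, a.1 ∈ oddLowest → b.1 ∉ oddLowest → f a ≠ f b := fun a b ha hb hab =>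
    (hfA ▸ ⟨mem_image_of_mem f ha, hab ▸ mem_image_of_mem f hb⟩ : f a ∈ (∅ : Set (Iio μ)))
  have hcl : ∀ a b, ¬ (a.1 ∈ oddLowest ↔ b.1 ∈ oddLowest) → (f a).1 ≠ (f b).1 := by
    intro a b hab heq
    by_cases ha : a.1 ∈ oddLowest
    · exact hne a b ha (by tauto) (Subtype.ext heq)
    · exact hne b a (by tauto) ha (Subtype.ext heq.symm)
  have hf' : Continuous fun a => (f a).1 := continuous_subtype_val.comp hf
  have hω : Ordinal.omega0 ≤ η := by
    by_contra! hlt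
    obtain ⟨n, rfl⟩ := Ordinal.lt_omega0.1 hlt
    refine hinf.not_finite (Set.Finite.to_subtype ?_)
    refine (Set.finite_range fun i : Fin n => ((i : ℕ) : Ordinal.{u})).subset fun a ha => ?_
    obtain ⟨m, rfl⟩ := Ordinal.lt_omega0.1 (ha.trans hlt)
    exact ⟨⟨m, Nat.cast_lt.1 (mem_Iio.1 ha)⟩, rfl⟩
  have hη : η ≠ 0 := (Ordinal.omega0_pos.trans_le hω).ne'
  have hlim : ¬ Order.IsSuccLimit η := by
    intro hl
    obtain ⟨m, -, hm⟩ := isCompact_univ.exists_isGreatest (univ_nonempty (α := Iio η))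
    exact (lt_add_one m.1).not_ge (hm (mem_univ ⟨m.1 + 1, hl.add_one_lt m.2⟩))
  set β := Ordinal.log Ordinal.omega0 η
  have hβ : 1 ≤ β := by
    rwa [← Ordinal.opow_le_iff_le_log Ordinal.one_lt_omega0 hη, Ordinal.opow_one]
  have hle : Ordinal.omega0 ^ β ≤ η := Ordinal.opow_log_le_self _ hη
  have hlt : Ordinal.omega0 ^ β < η := hle.lt_of_ne fun heq =>
    hlim (heq ▸ Ordinal.isSuccLimit_opow_left Ordinal.isSuccLimit_omega0
      (Order.one_le_iff_pos.1 hβ).ne')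
  have hpos : Ordinal.omega0 ^ β ≠ 0 := (Ordinal.opow_pos β Ordinal.omega0_pos).ne'
  let γ : Iio η := ⟨Ordinal.omega0 ^ β, hlt⟩
  have hdvd : Ordinal.omega0 ^ β ∣ (f γ).1 := opow_dvd_value hf' hcl β γ hpos dvd_rfl
  have hne0 : (f γ).1 ≠ 0 := by
    intro h0
    have hU : f ⁻¹' {y | y.1 < 1} ∈ 𝓝 γ :=
      (hf'.isOpen_preimage _ isOpen_Iio).mem_nhds (by simp [h0])
    rw [nhds_subtype, Filter.mem_comap] at hU
    obtain ⟨t, ht, hsub⟩ := hU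
    obtain ⟨l, hl, hlt'⟩ := exists_Ioc_subset_of_mem_nhds ht ⟨0, pos_iff_ne_zero.2 hpos⟩
    obtain ⟨γ', h1, h2, -, h4⟩ := exists_opposite_oddLowest (s := 0) hpos
      (Ordinal.opow_dvd_opow _ (by simpa using hβ)) hl
    have := @hsub ⟨γ', h1.trans hlt⟩ (hlt' ⟨h2, h1.le⟩)
    refine hcl ⟨γ', h1.trans hlt⟩ γ h4 ?_
    rw [h0]
    exact Order.lt_one_iff.1 this
  calc η < Ordinal.omega0 ^ (β + 1) := Ordinal.lt_opow_succ_log_self Ordinal.one_lt_omega0 η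
    _ = Ordinal.omega0 ^ β * Ordinal.omega0 := by rw [Ordinal.opow_add, Ordinal.opow_one]
    _ ≤ μ * Ordinal.omega0 := by
      gcongr
      exact (Ordinal.le_of_dvd hne0 hdvd).trans (f γ).2.le

theorem exists_isClopen_mem_notMem {X : Type u} [TopologicalSpace X]
    (H : ∀ A : Set X, ∃ f : X → Ordinal.{v}, Continuous f ∧ Cleaves f A) {x y : X} (hxy : x ≠ y) :
    ∃ U : Set X, IsClopen U ∧ x ∈ U ∧ y ∉ U := by
  obtain ⟨f, hf, hA⟩ := H {x}
  rcases (hA x rfl y hxy.symm).lt_or_gt with h | h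
  · exact ⟨f ⁻¹' Iic (f x), (isClopen_Iic_ordinal _).preimage hf, le_refl (f x), h.not_ge⟩
  · exact ⟨(f ⁻¹' Iic (f y))ᶜ, ((isClopen_Iic_ordinal _).preimage hf).compl, h.not_ge,
      fun h' => h' (le_refl (f y))⟩

/-- A set without isolated points contains the traces of a Cantor scheme of clopen sets. -/
theorem exists_clopen_cantorScheme {X : Type u} [TopologicalSpace X]
    (hsep : ∀ x y : X, x ≠ y → ∃ U : Set X, IsClopen U ∧ x ∈ U ∧ y ∉ U) {B : Set X}
    (hne : B.Nonempty) (hB : ∀ x ∈ B, ∀ U, IsOpen U → x ∈ U → ∃ y ∈ U ∩ B, y ≠ x) :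
    ∃ K : (ℕ → Bool) → ℕ → Set X, (∀ b n, IsClopen (K b n)) ∧ (∀ b n, (B ∩ K b n).Nonempty) ∧
      (∀ b n, K b (n + 1) ⊆ K b n) ∧ (∀ b b' n, (∀ m < n, b m = b' m) → K b n = K b' n) ∧
      ∀ b b', b ≠ b' → Disjoint (⋂ n, K b n) (⋂ n, K b' n) := by
  have hsplit : ∀ U : {U : Set X // IsClopen U ∧ (B ∩ U).Nonempty},
      ∃ s : Bool → {U : Set X // IsClopen U ∧ (B ∩ U).Nonempty},
        (∀ i, (s i).1 ⊆ U.1) ∧ ∀ i j, i ≠ j → Disjoint (s i).1 (s j).1 := by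
    rintro ⟨U, hU, x, hxB, hxU⟩
    obtain ⟨y, ⟨hyU, hyB⟩, hyx⟩ := hB x hxB U hU.isOpen hxU
    obtain ⟨V, hV, hyV, hxV⟩ := hsep y x hyx
    refine ⟨fun i => bif i then ⟨U ∩ V, hU.inter hV, y, hyB, hyU, hyV⟩ else
      ⟨U \ V, hU.diff hV, x, hxB, hxU, hxV⟩, ?_, ?_⟩
    · rintro (_ | _)
      exacts [sdiff_subset, inter_subset_left]
    · rintro (_ | _) (_ | _) hij
      · exact absurd rfl hij
      · exact disjoint_sdiff_left.mono_right inter_subset_right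
      · exact disjoint_sdiff_right.mono_left inter_subset_right
      · exact absurd rfl hij
  choose s hs hsd using hsplit
  let K : (ℕ → Bool) → ℕ → {U : Set X // IsClopen U ∧ (B ∩ U).Nonempty} := fun b n =>
    Nat.rec ⟨univ, isClopen_univ, by simpa using hne⟩ (fun n U => s U (b n)) n
  have hK : ∀ b n, K b (n + 1) = s (K b n) (b n) := fun b n => rfl
  have hcongr : ∀ b b' n, (∀ m < n, b m = b' m) → K b n = K b' n := by
    intro b b' n
    induction n with
    | zero => exact fun _ => rfl
    | succ n ih =>
      intro h
      rw [hK, hK, ih fun m hm => h m (hm.trans n.lt_succ_self), h n n.lt_succ_self]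
  refine ⟨fun b n => (K b n).1, fun b n => (K b n).2.1, fun b n => (K b n).2.2, fun b n => hs _ _,
    fun b b' n h => congrArg Subtype.val (hcongr b b' n h), fun b b' hbb => ?_⟩
  have hex : ∃ n, b n ≠ b' n := Function.ne_iff.1 hbb
  classical
  have hn := Nat.find_spec hex
  have hlt : ∀ m < Nat.find hex, b m = b' m := fun m hm => not_not.1 (Nat.find_min hex hm)
  refine Disjoint.mono (iInter_subset _ (Nat.find hex + 1)) (iInter_subset _ (Nat.find hex + 1)) ?_
  simp only [hK, hcongr b b' _ hlt]
  exact hsd _ _ _ hn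

theorem exists_minimal_isClosed_inter_nonempty {X : Type u} [TopologicalSpace X] [CompactSpace X]
    {ι : Type*} {L : ι → Set X} (hL : ∀ i, IsClosed (L i)) (hne : ∀ i, (L i).Nonempty) :
    ∃ B, Minimal (· ∈ {B : Set X | IsClosed B ∧ ∀ i, (B ∩ L i).Nonempty}) B := by
  refine (zorn_superset_nonempty {B : Set X | IsClosed B ∧ ∀ i, (B ∩ L i).Nonempty}
    (fun c hc hchain hcne => ?_) univ ⟨isClosed_univ, by simpa using hne⟩).imp fun B hB => hB.2
  refine ⟨⋂₀ c, ⟨isClosed_sInter fun s hs => (hc hs).1, fun i => ?_⟩, fun s hs =>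
    sInter_subset_of_mem hs⟩
  have : Nonempty c := hcne.to_subtype
  have hcl : ∀ s : c, IsClosed (s.1 ∩ L i) := fun s => (hc s.2).1.inter (hL i)
  have := IsCompact.nonempty_iInter_of_directed_nonempty_isCompact_isClosed
    (fun s : c => s.1 ∩ L i) (fun s t => ?_) (fun s => (hc s.2).2 i) (fun s => (hcl s).isCompact) hcl
  · rwa [← iInter_inter, ← sInter_eq_iInter] at this
  · rcases hchain.total s.2 t.2 with h | h
    · exact ⟨s, subset_rfl, inter_subset_inter_left _ h⟩
    · exact ⟨t, inter_subset_inter_left _ h, subset_rfl⟩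

theorem exists_isolated_of_cleaves {X : Type u} [TopologicalSpace X] [CompactSpace X]
    (H : ∀ A : Set X, ∃ f : X → Ordinal.{v}, Continuous f ∧ Cleaves f A) {B : Set X}
    (hBc : IsClosed B) (hne : B.Nonempty) : ∃ x ∈ B, ∃ U, IsOpen U ∧ x ∈ U ∧ U ∩ B ⊆ {x} := by
  by_contra! hcon
  obtain ⟨K, hKc, hKne, hKanti, hKcongr, hKd⟩ := exists_clopen_cantorScheme
    (fun x y hxy => exists_isClopen_mem_notMem H hxy) hne fun x hx U hU hxU => by
      simpa [not_subset, and_assoc] using hcon x hx U hU hxU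
  have hcompact : ∀ C : Set X, IsClosed C → ∀ b, (∀ n, (C ∩ K b n).Nonempty) →
      (C ∩ ⋂ n, K b n).Nonempty := by
    intro C hC b hn
    have := IsCompact.nonempty_iInter_of_sequence_nonempty_isCompact_isClosed (fun n => C ∩ K b n)
      (fun n => inter_subset_inter_right _ (hKanti b n)) hn
      (hC.inter (hKc b 0).isClosed).isCompact fun n => hC.inter (hKc b n).isClosed
    rwa [← inter_iInter] at this
  obtain ⟨C, ⟨hC, hCne⟩, hmin⟩ := exists_minimal_isClosed_inter_nonempty
    (fun b => isClosed_iInter fun n => (hKc b n).isClosed)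
    fun b => (hcompact B hBc b (hKne b)).mono inter_subset_right
  obtain ⟨f, hf, hA⟩ := H {y | ∃ b : ℕ → Bool, (∃ N, ∀ n ≥ N, b n = false) ∧ y ∈ ⋂ n, K b n}
  obtain ⟨y₀, hy₀, hy₀min⟩ := hC.isCompact.exists_isMinOn
    ((hCne fun _ => false).mono inter_subset_left) hf.continuousOn
  have hC' : IsClosed (C ∩ (f ⁻¹' Iic (f y₀))ᶜ) :=
    hC.inter ((isClopen_Iic_ordinal _).preimage hf).compl.isClosed
  have hnot : ∃ b n, C ∩ (f ⁻¹' Iic (f y₀))ᶜ ∩ K b n = ∅ := by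
    by_contra! h
    exact (hmin ⟨hC', fun b => hcompact _ hC' b (h b)⟩ inter_subset_left hy₀).2 (le_refl (f y₀))
  obtain ⟨b, n, hbn⟩ := hnot
  have hval : ∀ b', (∀ m < n, b' m = b m) → ∃ y ∈ ⋂ n, K b' n, f y = f y₀ := by
    intro b' hb'
    obtain ⟨y, hyC, hy⟩ := hCne b'
    refine ⟨y, hy, le_antisymm (not_not.1 fun hlt => ?_) (hy₀min hyC)⟩
    have hyK : y ∈ K b n := hKcongr b' b n hb' ▸ mem_iInter.1 hy n
    exact (hbn ▸ (⟨⟨hyC, hlt⟩, hyK⟩ : y ∈ C ∩ (f ⁻¹' Iic (f y₀))ᶜ ∩ K b n) : y ∈ (∅ : Set X))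
  obtain ⟨y, hy, hfy⟩ := hval (fun m => if m < n then b m else false) fun m hm => if_pos hm
  obtain ⟨z, hz, hfz⟩ := hval (fun m => if m < n then b m else true) fun m hm => if_pos hm
  refine hA y ⟨_, ⟨n, fun m hm => if_neg hm.not_gt⟩, hy⟩ z ?_ (hfy.trans hfz.symm)
  rintro ⟨b', ⟨N, hN⟩, hz'⟩
  refine disjoint_left.1 (hKd b' _ fun h => ?_) hz' hz
  have h1 := hN (max n N) (le_max_right _ _)
  rw [h] at h1
  simp at h1

theorem IsClosed.injectsInOrdinals {X : Type u} [TopologicalSpace X] [CompactSpace X] [T2Space X]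
    [TotallyDisconnectedSpace X] {K : Set X} (hK : IsClosed K)
    (h : ∀ x ∈ K, ∃ U, IsOpen U ∧ x ∈ U ∧ InjectsInOrdinals.{u, v} U) :
    InjectsInOrdinals.{u, v} K := by
  obtain ⟨V, -, hKV, hV⟩ := hK.isCompact.induction_on
    (p := fun s => ∃ V, IsClopen V ∧ s ⊆ V ∧ InjectsInOrdinals.{u, v} V)
    ⟨∅, isClopen_empty, subset_rfl, subsingleton_empty.injectsInOrdinals⟩
    (fun s t hst ⟨V, hV, htV, hV'⟩ => ⟨V, hV, hst.trans htV, hV'⟩)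
    (fun s t ⟨V, hV, hsV, hV'⟩ ⟨W, hW, htW, hW'⟩ =>
      ⟨V ∪ W, hV.union hW, union_subset_union hsV htW, hV'.union hV hW'⟩)
    fun x hx => by
      obtain ⟨U, hU, hxU, hU'⟩ := h x hx
      obtain ⟨V, hV, hxV, hVU⟩ := compact_exists_isClopen_in_isOpen hU hxU
      exact ⟨V, mem_nhdsWithin_of_mem_nhds (hV.isOpen.mem_nhds hxV), V, hV, subset_rfl,
        hU'.mono hVU⟩
  exact hV.mono hKV

theorem injectsInOrdinals_univ {X : Type u} [TopologicalSpace X] [CompactSpace X] [T2Space X]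
    (H : ∀ A : Set X, ∃ f : X → Ordinal.{v}, Continuous f ∧ Cleaves f A) :
    InjectsInOrdinals.{u, v} (univ : Set X) := by
  have : TotallySeparatedSpace X := totallySeparatedSpace_iff_exists_isClopen.2
    fun x y hxy => exists_isClopen_mem_notMem H hxy
  by_contra hbad
  let G : Set X := {x | ∃ U, IsOpen U ∧ x ∈ U ∧ InjectsInOrdinals.{u, v} U}
  have hG : IsOpen G := isOpen_iff_forall_mem_open.2 fun x ⟨U, hU, hxU, hU'⟩ =>
    ⟨U, fun y hy => ⟨U, hU, hy, hU'⟩, hU, hxU⟩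
  have hne : Gᶜ.Nonempty := by
    by_contra! h
    exact hbad (isClosed_univ.injectsInOrdinals fun x _ => eq_univ_iff_forall.1 (compl_empty_iff.1 h) x)
  obtain ⟨x, hx, U, hU, hxU, hUB⟩ := exists_isolated_of_cleaves H hG.isClosed_compl hne
  have hxo : ¬ IsOpen {x} := fun h =>
    hx ⟨{x}, h, rfl, subsingleton_singleton.injectsInOrdinals⟩
  obtain ⟨V, hV, hxV, hVU⟩ := compact_exists_isClopen_in_isOpen hU hxU
  obtain ⟨g, hg, hlim, hgx⟩ := exists_continuous_isSuccLimit_injective H hxo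
  refine hx ⟨V, hV.isOpen, hxV, injectsInOrdinals_of_fibers hg hlim fun γ hγ =>
    (hV.isClosed.inter (isClosed_singleton.preimage hg)).injectsInOrdinals fun y hy => ?_⟩
  by_contra hyG
  have hyx : y = x := hUB ⟨hVU hy.1, hyG⟩
  exact hγ (by rwa [← show g y = γ from hy.2, hyx])

theorem exists_homeomorph_Iio_of_cleavable {X : Type u} [TopologicalSpace X] [CompactSpace X]
    [T2Space X] {μ : Ordinal.{v}} (h : Cleavable X (Iio μ)) :
    ∃ η : Ordinal.{v}, Nonempty (X ≃ₜ Iio η) := by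
  obtain ⟨φ, hφ, hinj⟩ := injectsInOrdinals_univ.{u, v} (X := X) fun A => by
    obtain ⟨f, hf, hA⟩ := h A
    refine ⟨fun y => f y, continuous_subtype_val.comp hf, fun y hy z hz hyz => ?_⟩
    have : f y ∈ f '' A ∩ f '' Aᶜ :=
      ⟨mem_image_of_mem f hy, z, hz, Subtype.ext hyz.symm⟩
    exact (hA ▸ this : f y ∈ (∅ : Set (Iio μ)))
  exact exists_homeomorph_Iio hφ (injOn_univ.1 hinj)

theorem Cleavable.of_homeomorph {X Y Z : Type*} [TopologicalSpace X] [TopologicalSpace Y]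
    [TopologicalSpace Z] (h : Cleavable X Z) (e : X ≃ₜ Y) : Cleavable Y Z := by
  intro A
  obtain ⟨f, hf, hA⟩ := h (e ⁻¹' A)
  refine ⟨f ∘ e.symm, hf.comp e.symm.continuous, ?_⟩
  rwa [image_comp, image_comp, e.symm.image_eq_preimage_symm, e.symm.image_eq_preimage_symm]

theorem homeomorphic_ordinal_lt_mul_omega (X : Type*) [TopologicalSpace X] [Infinite X]
    [CompactSpace X] [T2Space X] (μ : Ordinal) (hcleav : Cleavable X (Set.Iio μ))
    (hleast : ∀ ν : Ordinal, ν < μ → ¬ Cleavable X (Set.Iio ν)) :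
    ∃ η : Ordinal, η < μ * Ordinal.omega0 ∧ Nonempty (X ≃ₜ Set.Iio η) := by
  obtain ⟨η, ⟨e⟩⟩ := exists_homeomorph_Iio_of_cleavable hcleav
  have : CompactSpace (Iio η) := e.compactSpace
  exact ⟨η, lt_mul_omega0_of_cleavable (e.infinite_iff.1 ‹_›) (hcleav.of_homeomorph e), ⟨e⟩⟩
end

section
/- Let β be an uncountable regular ordinal (there is a regular cardinal κ with Cardinal.aleph0 < κ and β = κ.ord). Then for every j ∈ {2, 3, 4} and every natural number k < j, the space Set.Iio (β * j + 1) (i.e. the ordinal β·j + 1) is not cleavable over the space Set.Iio (β * k + 1) (i.e. the ordinal β·k + 1): there exists a subset A of Set.Iio (β * j + 1) such that no continuous map f : Set.Iio (β * j + 1) → Set.Iio (β * k + 1) satisfies f '' A ∩ f '' (Set.Iio (β * j + 1) \ A) = ∅. -/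
open Set Topology

universe u

/-- `α` is a limit ordinal below `β` that is closed under `h`. For regular `β`, the sets of such
points generate the club filter on `β`. -/
def IsClosurePoint (β : Ordinal.{u}) (h : Ordinal.{u} → Ordinal.{u}) (α : Ordinal.{u}) : Prop :=
  Order.IsSuccLimit α ∧ α < β ∧ ∀ γ < α, h γ < α

lemma Cardinal.IsRegular.exists_bound {κ : Cardinal.{u}} (hr : κ.IsRegular) {ι : Type u}
    (hι : Cardinal.mk ι < κ) (f : ι → Ordinal.{u}) (hf : ∀ i, f i < κ.ord) :
    ∃ b < κ.ord, ∀ i, f i ≤ b := by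
  refine ⟨⨆ i, f i, Ordinal.iSup_lt_of_lt_cof (by rwa [hr.cof_ord]) hf, fun i => ?_⟩
  exact le_ciSup Ordinal.bddAbove_of_small i

lemma Cardinal.IsRegular.exists_bound_nat {κ : Cardinal.{u}} (hr : κ.IsRegular)
    (hκ : Cardinal.aleph0 < κ) (f : ℕ → Ordinal.{u}) (hf : ∀ n, f n < κ.ord) :
    ∃ b < κ.ord, ∀ n, f n ≤ b := by
  obtain ⟨b, hb, hb'⟩ := hr.exists_bound (ι := ULift.{u} ℕ) (by simpa using hκ)
    (fun n => f n.down) (fun n => hf n.down)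
  exact ⟨b, hb, fun n => hb' ⟨n⟩⟩

lemma Cardinal.IsRegular.exists_bound_Iio {κ : Cardinal.{u}} (hr : κ.IsRegular)
    {γ : Ordinal.{u}} (hγ : γ < κ.ord) (f : Ordinal.{u} → Ordinal.{u})
    (hf : ∀ x < γ, f x < κ.ord) : ∃ b < κ.ord, ∀ x < γ, f x ≤ b := by
  obtain ⟨b, hb, hb'⟩ := hr.exists_bound (ι := γ.ToType)
    (by rwa [Cardinal.mk_toType, ← Cardinal.lt_ord])
    (fun i => f (Ordinal.ToType.mk.symm i : Iio γ))
    (fun i => hf _ (Ordinal.ToType.mk.symm i : Iio γ).2)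
  exact ⟨b, hb, fun x hx => by simpa using hb' (Ordinal.ToType.mk ⟨x, hx⟩)⟩

lemma Cardinal.IsRegular.isSuccLimit_ord {κ : Cardinal.{u}} (hr : κ.IsRegular) :
    Order.IsSuccLimit κ.ord :=
  Cardinal.isSuccLimit_ord hr.aleph0_le

/-- The diagonal intersection of clubs contains arbitrarily large points of countable cofinality. -/
lemma exists_diagonal_closurePoint {κ : Cardinal.{u}} (hκ : Cardinal.aleph0 < κ)
    (hr : κ.IsRegular) (H : Ordinal.{u} → Ordinal.{u} → Ordinal.{u})
    (hH : ∀ δ < κ.ord, MapsTo (H δ) (Iio κ.ord) (Iio κ.ord)) {γ₀ : Ordinal.{u}}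
    (hγ₀ : γ₀ < κ.ord) :
    ∃ α, γ₀ < α ∧ (∀ δ < α, IsClosurePoint κ.ord (H δ) α) ∧
      ∃ l : ℕ → Ordinal.{u}, (∀ n, l n < α) ∧ ∀ γ < α, ∃ n, γ ≤ l n := by
  have hlim := hr.isSuccLimit_ord
  have hb : ∀ ε, ∃ b, ε < κ.ord → b < κ.ord ∧ ∀ δ < ε, ∀ γ < ε, H δ γ ≤ b := by
    intro ε
    by_cases hε : ε < κ.ord
    · have h1 : ∀ δ, ∃ b, δ < ε → b < κ.ord ∧ ∀ γ < ε, H δ γ ≤ b := by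
        intro δ
        by_cases hδ : δ < ε
        · obtain ⟨b, hb, hb'⟩ := hr.exists_bound_Iio hε (H δ)
            (fun x hx => hH δ (hδ.trans hε) (hx.trans hε))
          exact ⟨b, fun _ => ⟨hb, hb'⟩⟩
        · exact ⟨0, fun h => absurd h hδ⟩
      choose c hc using h1
      obtain ⟨b, hb, hb'⟩ := hr.exists_bound_Iio hε c (fun x hx => (hc x hx).1)
      exact ⟨b, fun _ => ⟨hb, fun δ hδ γ hγ => ((hc δ hδ).2 γ hγ).trans (hb' δ hδ)⟩⟩
    · exact ⟨0, fun h => absurd h hε⟩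
  choose b hb using hb
  let l : ℕ → Ordinal.{u} := fun n => Nat.rec (Order.succ γ₀) (fun _ x => Order.succ (max x (b x))) n
  have l0 : l 0 = Order.succ γ₀ := rfl
  have ls : ∀ n, l (n + 1) = Order.succ (max (l n) (b (l n))) := fun n => rfl
  have hlt : ∀ n, l n < κ.ord := by
    intro n
    induction n with
    | zero => exact hlim.succ_lt hγ₀
    | succ n ih => rw [ls]; exact hlim.succ_lt (max_lt ih (hb _ ih).1)
  have hstep : ∀ n, l n < l (n + 1) := fun n => by
    rw [ls, Order.lt_succ_iff]; exact le_max_left _ _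
  have hmono : StrictMono l := strictMono_nat_of_lt_succ hstep
  obtain ⟨c, hc, hc'⟩ := hr.exists_bound_nat hκ l hlt
  have hbdd : BddAbove (range l) := ⟨c, by rintro _ ⟨n, rfl⟩; exact hc' n⟩
  have hlα : ∀ n, l n < ⨆ n, l n := fun n => (hstep n).trans_le (le_ciSup hbdd (n + 1))
  have hex : ∀ γ < ⨆ n, l n, ∃ n, γ < l n := fun γ hγ => exists_lt_of_lt_ciSup hγ
  have hακ : ⨆ n, l n < κ.ord := (ciSup_le hc').trans_lt hc
  refine ⟨⨆ n, l n, ?_, fun δ hδ => ⟨?_, hακ, fun γ hγ => ?_⟩, l, hlα,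
    fun γ hγ => (hex γ hγ).imp fun _ => le_of_lt⟩
  · exact (Order.lt_succ γ₀).trans (hlα 0)
  · refine Ordinal.isSuccLimit_iff.2 ⟨((zero_le).trans_lt (hlα 0)).ne', ?_⟩
    refine Order.isSuccPrelimit_of_succ_lt fun γ hγ => ?_
    obtain ⟨n, hn⟩ := hex γ hγ
    exact (Order.succ_le_of_lt hn).trans_lt (hlα n)
  · obtain ⟨n, hn⟩ := hex _ (max_lt hδ hγ)
    have hδγ := max_lt_iff.1 hn
    calc H δ γ ≤ b (l n) := (hb _ (hlt n)).2 δ hδγ.1 γ hδγ.2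
      _ < l (n + 1) := by rw [ls, Order.lt_succ_iff]; exact le_max_right _ _
      _ < ⨆ n, l n := hlα (n + 1)

/-- There is a set of ordinals which is stationary and co-stationary in `κ.ord`. -/
lemma exists_bistationary {κ : Cardinal.{u}} (hκ : Cardinal.aleph0 < κ) (hr : κ.IsRegular) :
    ∃ S : Set Ordinal.{u}, ∀ h, MapsTo h (Iio κ.ord) (Iio κ.ord) →
      (∃ α ∈ S, IsClosurePoint κ.ord h α) ∧ ∃ α ∉ S, IsClosurePoint κ.ord h α := by
  by_contra! hcon
  have hdich : ∀ S : Set Ordinal.{u}, ∃ h, MapsTo h (Iio κ.ord) (Iio κ.ord) ∧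
      ((∀ α, IsClosurePoint κ.ord h α → α ∈ S) ∨ (∀ α, IsClosurePoint κ.ord h α → α ∉ S)) := by
    intro S
    obtain ⟨h, hm, hh⟩ := hcon S
    by_cases hS : ∃ α ∈ S, IsClosurePoint κ.ord h α
    · exact ⟨h, hm, Or.inl fun α hα => by_contra fun hn => hh hS α hn hα⟩
    · exact ⟨h, hm, Or.inr fun α hα hn => hS ⟨α, hn, hα⟩⟩
  have hlad : ∀ α : Ordinal.{u}, ∃ l : ℕ → Ordinal.{u},
      (∃ l : ℕ → Ordinal.{u}, (∀ n, l n < α) ∧ ∀ γ < α, ∃ n, γ ≤ l n) →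
        (∀ n, l n < α) ∧ ∀ γ < α, ∃ n, γ ≤ l n := by
    intro α
    by_cases h : ∃ l : ℕ → Ordinal.{u}, (∀ n, l n < α) ∧ ∀ γ < α, ∃ n, γ ≤ l n
    · exact h.imp fun l hl _ => hl
    · exact ⟨fun _ => 0, fun h' => absurd h' h⟩
  choose L hL using hlad
  choose h hm hh using fun n γ => hdich {α | L α n < γ}
  by_cases hcase : ∀ n, ∃ γ < κ.ord, ∀ α, IsClosurePoint κ.ord (h n γ) α → L α n < γ
  · choose γ hγ hγ' using hcase
    obtain ⟨c, hc, hc'⟩ := hr.exists_bound_nat hκ γ hγ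
    have hω : Ordinal.omega0 < κ.ord := by rwa [Cardinal.lt_ord, Ordinal.card_omega0]
    obtain ⟨α, hα, hcl, hα'⟩ := exists_diagonal_closurePoint hκ hr
      (fun δ => h (Cardinal.toNat δ.card) (γ (Cardinal.toNat δ.card))) (fun δ _ => hm _ _)
      (max_lt hc hω)
    obtain ⟨-, h2⟩ := hL α hα'
    obtain ⟨n, hn⟩ := h2 c ((le_max_left _ _).trans_lt hα)
    refine absurd (hγ' n α ?_) (not_lt.2 ((hc' n).trans hn))
    simpa using hcl n ((Ordinal.natCast_lt_omega0 n).trans ((le_max_right _ _).trans_lt hα))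
  · push Not at hcase
    obtain ⟨n, hn⟩ := hcase
    have hge : ∀ γ < κ.ord, ∀ α, IsClosurePoint κ.ord (h n γ) α → γ ≤ L α n := by
      intro γ hγ
      obtain ⟨α, hα, hα'⟩ := hn γ hγ
      rcases hh n γ with h1 | h1
      · exact absurd (h1 α hα) (not_lt.2 hα')
      · exact fun α hα => not_lt.1 (h1 α hα)
    obtain ⟨α, hα, hcl, hα'⟩ := exists_diagonal_closurePoint hκ hr (h n) (fun δ _ => hm _ _)
      hr.ord_pos
    obtain ⟨h1, -⟩ := hL α hα'
    have hcl0 := hcl 0 hα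
    have hs : Order.succ (L α n) < α := hcl0.1.succ_lt (h1 n)
    exact absurd (hge _ (hs.trans hcl0.2.1) α (hcl _ hs)) (not_le.2 (Order.lt_succ _))

/-- A continuous map from `κ.ord + 1` into `κ.ord * k + 1` is, on a club, either constant or a
translation onto one of the `k` copies of `κ.ord`. -/
lemma Continuous.exists_closurePoint_dichotomy {κ : Cardinal.{u}} (hr : κ.IsRegular) {k : ℕ}
    {φ : Ordinal.{u} → Ordinal.{u}} (hφ : Continuous φ)
    (hk : φ κ.ord ≤ κ.ord * (k : Ordinal)) :
    ∃ h, MapsTo h (Iio κ.ord) (Iio κ.ord) ∧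
      ((∀ α, IsClosurePoint κ.ord h α → φ α = φ κ.ord) ∨
        ∃ i < k, φ κ.ord = κ.ord * ((i + 1 : ℕ) : Ordinal) ∧
          ∀ α, IsClosurePoint κ.ord h α → φ α = κ.ord * (i : Ordinal) + α) := by
  have hlim := hr.isSuccLimit_ord
  have hpos := hr.ord_pos
  have hnhds : ∀ {α : Ordinal.{u}} {U : Set Ordinal.{u}}, 0 < α → IsOpen U → φ α ∈ U →
      ∃ l < α, ∀ x, l < x → x ≤ α → φ x ∈ U := by
    intro α U hα hU hαU
    obtain ⟨l, hl, hl'⟩ := exists_Ioc_subset_of_mem_nhds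
      (hφ.continuousAt.preimage_mem_nhds (hU.mem_nhds hαU)) ⟨0, hα⟩
    exact ⟨l, hl, fun x hx hx' => hl' ⟨hx, hx'⟩⟩
  by_cases hcase : ∀ γ < κ.ord, ∃ x < κ.ord, γ < x ∧ φ x = φ κ.ord
  · choose! h hlt hγ heq using hcase
    refine ⟨h, hlt, Or.inl fun α hα => by_contra fun hne => ?_⟩
    obtain ⟨l, hl, hl'⟩ := hnhds (U := {φ κ.ord}ᶜ) hα.1.bot_lt isOpen_compl_singleton hne
    have hlκ := hl.trans hα.2.1
    exact hl' (h l) (hγ l hlκ) (hα.2.2 l hl).le (heq l hlκ)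
  · push Not at hcase
    obtain ⟨δ₀, hδ₀, hne⟩ := hcase
    have hIio : ∃ δ < κ.ord, ∀ x, δ < x → x < κ.ord → φ x < φ κ.ord := by
      obtain ⟨l, hl, hl'⟩ := hnhds (U := Iio (Order.succ (φ κ.ord))) hpos isOpen_Iio
        (Order.lt_succ (φ κ.ord))
      refine ⟨max l δ₀, max_lt hl hδ₀, fun x hx hx' => ?_⟩
      rw [max_lt_iff] at hx
      exact lt_of_le_of_ne (Order.lt_succ_iff.1 (hl' x hx.1 hx'.le)) (hne x hx' hx.2)
    obtain ⟨δ₁, hδ₁, hlt⟩ := hIio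
    have hgt : ∀ u < φ κ.ord, ∃ δ < κ.ord, ∀ x, δ < x → x < κ.ord → u < φ x := by
      intro u hu
      obtain ⟨l, hl, hl'⟩ := hnhds (U := Ioi u) hpos isOpen_Ioi hu
      exact ⟨l, hl, fun x hx hx' => hl' x hx hx'.le⟩
    choose! d hd hd' using hgt
    have hmod : φ κ.ord % κ.ord = 0 := by
      by_contra hr0
      have hv := Ordinal.div_add_mod (φ κ.ord) κ.ord
      have hrlt := Ordinal.mod_lt (φ κ.ord) hpos.ne'
      set q := φ κ.ord / κ.ord
      set r := φ κ.ord % κ.ord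
      have hs : ∀ s < r, κ.ord * q + s < φ κ.ord := fun s hs => by
        rw [← hv]; exact (add_lt_add_iff_left _).2 hs
      obtain ⟨b, hb, hb'⟩ := hr.exists_bound_Iio hrlt (fun s => d (κ.ord * q + s))
        (fun s hs' => hd _ (hs s hs'))
      have hx := hlim.succ_lt (max_lt hb hδ₁)
      set x := Order.succ (max b δ₁)
      have hxb : max b δ₁ < x := Order.lt_succ _
      rw [max_lt_iff] at hxb
      have hxv := hlt x hxb.2 hx
      have hsub : φ x - κ.ord * q < r :=
        Ordinal.sub_lt_of_lt_add (by rwa [hv]) (pos_iff_ne_zero.2 hr0)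
      have := hd' _ (hs _ hsub) x ((hb' _ hsub).trans_lt hxb.1) hx
      exact absurd this (not_lt.2 (Ordinal.le_add_sub _ _))
    have hv : κ.ord * (φ κ.ord / κ.ord) = φ κ.ord := by
      conv_rhs => rw [← Ordinal.div_add_mod (φ κ.ord) κ.ord, hmod, add_zero]
    have hqk : φ κ.ord / κ.ord ≤ k := by
      rw [← hv] at hk
      exact le_of_mul_le_mul_left hk hpos
    obtain ⟨m, hm⟩ := Ordinal.lt_omega0.1 (hqk.trans_lt (Ordinal.natCast_lt_omega0 k))
    rw [hm] at hv hqk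
    have hv0 : φ κ.ord ≠ 0 := by
      intro h0
      have := hlt _ (Order.lt_succ δ₁) (hlim.succ_lt hδ₁)
      rw [h0] at this
      exact not_lt_zero this
    obtain _ | i := m
    · simp [hv0.symm] at hv
    have hvi : φ κ.ord = κ.ord * i + κ.ord := by
      rw [← hv]; push_cast; rw [mul_add, mul_one]
    have hadd : ∀ γ < κ.ord, κ.ord * i + γ < φ κ.ord := fun γ hγ => by
      rw [hvi]; exact (add_lt_add_iff_left _).2 hγ
    classical
    refine ⟨fun γ => max (max (d (κ.ord * i + γ)) δ₁) (if δ₁ < γ then φ γ - κ.ord * i else 0),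
      fun γ hγ => ?_, Or.inr ⟨i, Nat.cast_le.1 hqk, hv.symm, fun α hα => ?_⟩⟩
    · refine max_lt (max_lt (hd _ (hadd γ hγ)) hδ₁) ?_
      split_ifs with h
      · exact Ordinal.sub_lt_of_lt_add (hvi ▸ hlt γ h hγ) hpos
      · exact hpos
    · obtain ⟨hαlim, hακ, hcl⟩ := hα
      simp only [max_lt_iff] at hcl
      have hα0 : 0 < α := hαlim.bot_lt
      have hδα : δ₁ < α := (hcl 0 hα0).1.2
      apply le_antisymm
      · by_contra! hcon
        obtain ⟨l, hl, hl'⟩ := hnhds (U := Ioi (κ.ord * i + α)) hα0 isOpen_Ioi hcon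
        have hx := hαlim.succ_lt (max_lt hl hδα)
        set x := Order.succ (max l δ₁)
        have hxl : max l δ₁ < x := Order.lt_succ _
        rw [max_lt_iff] at hxl
        have h1 : κ.ord * i + α < φ x := hl' x hxl.1 hx.le
        have h2 := (hcl x hx).2
        rw [if_pos hxl.2] at h2
        exact absurd (Ordinal.lt_sub.2 h1) (not_lt.2 h2.le)
      · by_contra! hcon
        have hγ := Ordinal.sub_lt_of_lt_add hcon hα0
        have := hd' _ (hadd _ (hγ.trans hακ)) α (hcl _ hγ).1.1 hακ
        exact absurd this (not_lt.2 (Ordinal.le_add_sub _ _))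

theorem mul_succ_not_cleavable (β : Ordinal)
    (hreg : ∃ κ : Cardinal, Cardinal.aleph0 < κ ∧ κ.IsRegular ∧ β = κ.ord)
    (j : ℕ) (hj : j ∈ ({2, 3, 4} : Set ℕ)) (k : ℕ) (hk : k < j) :
    ∃ A : Set (Set.Iio (β * (j : Ordinal) + 1)),
      ∀ f : Set.Iio (β * (j : Ordinal) + 1) → Set.Iio (β * (k : Ordinal) + 1),
        Continuous f → f '' A ∩ f '' Aᶜ ≠ ∅ := by
  obtain ⟨κ, hκ, hr, rfl⟩ := hreg
  have hj4 : j ≤ 4 := by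
    simp only [mem_insert_iff, mem_singleton_iff] at hj
    omega
  have hpos := hr.ord_pos
  obtain ⟨S, hS⟩ := exists_bistationary hκ hr
  obtain ⟨P, hPlim, hPtop⟩ : ∃ P : Ordinal → Prop,
      (∀ m : ℕ, ∀ α, 0 < α → α < κ.ord → (P (κ.ord * m + α) ↔ (α ∈ S ↔ (m = 0 ∨ m = 2)))) ∧
      ∀ m : ℕ, P (κ.ord * m + κ.ord) ↔ 2 ≤ m := by
    refine ⟨fun x => (x % κ.ord = 0 ∧ κ.ord * (3 : ℕ) ≤ x) ∨
      (x % κ.ord ≠ 0 ∧ (x % κ.ord ∈ S ↔ (x / κ.ord = (0 : ℕ) ∨ x / κ.ord = (2 : ℕ)))),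
      fun m α h0 hα => ?_, fun m => ?_⟩
    · have hmod : (κ.ord * m + α) % κ.ord = α := by
        rw [Ordinal.mul_add_mod_self, Ordinal.mod_eq_of_lt hα]
      have hdiv : (κ.ord * m + α) / κ.ord = m := by
        rw [Ordinal.mul_add_div _ hpos.ne', Ordinal.div_eq_zero_of_lt hα, add_zero]
      simp only [hmod, hdiv, h0.ne', Nat.cast_inj, false_and, false_or, ne_eq, not_false_eq_true,
        true_and]
    · have hm : κ.ord * m + κ.ord = κ.ord * ((m + 1 : ℕ) : Ordinal) := by
        push_cast; rw [mul_add, mul_one]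
      rw [hm]
      have hmod : (κ.ord * ((m + 1 : ℕ) : Ordinal)) % κ.ord = 0 := Ordinal.mul_mod _ _
      simp only [hmod, ne_eq, not_true_eq_false, false_and, or_false, true_and]
      rw [mul_le_mul_iff_right₀ hpos, Nat.cast_le]
      omega
  refine ⟨{x | P x}, fun f hf hdisj => ?_⟩
  have hsep : ∀ x y, f x = f y → (P x ↔ P y) := by
    have : ∀ x y, f x = f y → P x → P y := fun x y hxy hx => by_contra fun hy =>
      (hdisj ▸ ⟨⟨x, hx, rfl⟩, ⟨y, hy, hxy.symm⟩⟩ : f x ∈ (∅ : Set _))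
    exact fun x y hxy => ⟨this x y hxy, this y x hxy.symm⟩
  have hmem : ∀ (m : Fin j) (x : Ordinal), κ.ord * (m : ℕ) + min x κ.ord < κ.ord * j + 1 := by
    intro m x
    rw [← Order.succ_eq_add_one, Order.lt_succ_iff]
    calc κ.ord * (m : ℕ) + min x κ.ord
        ≤ κ.ord * (m : ℕ) + κ.ord := by gcongr; exact min_le_right _ _
      _ = κ.ord * ((m + 1 : ℕ) : Ordinal) := by push_cast; rw [mul_add, mul_one]
      _ ≤ κ.ord * j := by gcongr; exact m.2
  let e : Fin j → Ordinal → Iio (κ.ord * (j : Ordinal) + 1) := fun m x => ⟨_, hmem m x⟩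
  have he : ∀ m x, x ≤ κ.ord → (e m x : Ordinal) = κ.ord * (m : ℕ) + x := fun m x hx => by
    simp only [e, min_eq_left hx]
  have hcont : ∀ m, Continuous fun x => (f (e m x) : Ordinal) := fun m =>
    continuous_subtype_val.comp (hf.comp (((Ordinal.isNormal_add_right _).continuous.comp
      (continuous_id.min continuous_const)).subtype_mk _))
  have hcopy : ∀ m, ∃ h, MapsTo h (Iio κ.ord) (Iio κ.ord) ∧ ∃ i : Fin k,
      (f (e m κ.ord) : Ordinal) = κ.ord * ((i + 1 : ℕ) : Ordinal) ∧
        ∀ α, IsClosurePoint κ.ord h α → (f (e m α) : Ordinal) = κ.ord * (i : ℕ) + α := by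
    intro m
    obtain ⟨h, hm, hconst | ⟨i, hi, h1, h2⟩⟩ := (hcont m).exists_closurePoint_dichotomy hr (k := k)
      (Order.lt_succ_iff.1 (f (e m κ.ord)).2)
    · obtain ⟨⟨α, hα, hαc⟩, ⟨α', hα', hαc'⟩⟩ := hS h hm
      have := hsep (e m α) (e m α') (Subtype.ext ((hconst α hαc).trans (hconst α' hαc').symm))
      rw [he _ _ hαc.2.1.le, he _ _ hαc'.2.1.le, hPlim _ _ hαc.1.bot_lt hαc.2.1,
        hPlim _ _ hαc'.1.bot_lt hαc'.2.1] at this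
      tauto
    · exact ⟨h, hm, ⟨i, hi⟩, h1, h2⟩
  choose h hm i htop hi using hcopy
  obtain ⟨a, b, hab, hiab⟩ := Fintype.exists_ne_map_eq_of_card_lt i (by simpa using hk)
  have h1 := hsep (e a κ.ord) (e b κ.ord) (Subtype.ext (by rw [htop, htop, hiab]))
  rw [he _ _ le_rfl, he _ _ le_rfl, hPtop, hPtop] at h1
  obtain ⟨⟨α, -, hα⟩, -⟩ := hS (fun γ => max (h a γ) (h b γ))
    fun γ hγ => show max (h a γ) (h b γ) < κ.ord from max_lt (hm a hγ) (hm b hγ)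
  have hαa : IsClosurePoint κ.ord (h a) α :=
    ⟨hα.1, hα.2.1, fun γ hγ => (le_max_left _ _).trans_lt (hα.2.2 γ hγ)⟩
  have hαb : IsClosurePoint κ.ord (h b) α :=
    ⟨hα.1, hα.2.1, fun γ hγ => (le_max_right _ _).trans_lt (hα.2.2 γ hγ)⟩
  have h2 := hsep (e a α) (e b α) (Subtype.ext (by rw [hi a α hαa, hi b α hαb, hiab]))
  rw [he _ _ hα.2.1.le, he _ _ hα.2.1.le, hPlim _ _ hα.1.bot_lt hα.2.1,
    hPlim _ _ hα.1.bot_lt hα.2.1] at h2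
  have h3 : ((a : ℕ) = 0 ∨ (a : ℕ) = 2) ↔ ((b : ℕ) = 0 ∨ (b : ℕ) = 2) := by tauto
  have := a.2
  have := b.2
  exact hab (Fin.ext (by omega))
end
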